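/- For every angle θ ∈ (0, π) there exist seven lines L₀, …, L₆ in ℝ³, pairwise non-parallel, such that the infimum distance between any two of them equals 2 and the angle between the direction vectors of L₀ and L₁ equals θ. That is, the configuration of seven mutually touching unit-radius cylinders admits one residual degree of freedom: the scissor angle θ₁ between the axes of the 0th and 1st cylinders can take any value in (0, π). -/

import Mathlib

/-- The infimum of the Euclidean distance between points of the line `{p₁ + t • v₁}`
and points of the line `{p₂ + t • v₂}`. -/
noncomputable def lineDist (p₁ v₁ p₂ v₂ : EuclideanSpace ℝ (Fin 3)) : ℝ :=
  sInf {d : ℝ | ∃ t₁ t₂ : ℝ, d = dist (p₁ + t₁ • v₁) (p₂ + t₂ • v₂)}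

noncomputable section

/-! ### Integer arithmetic for evaluation in the kernel

The following operations agree with the usual ones, but they apply the recursors directly, which
needs fewer reduction steps. -/

/-- The integer `-n`. -/
def negOfNatRec (n : ℕ) : ℤ :=
  Nat.rec (motive := fun _ => ℤ) (Int.ofNat 0) (fun k _ => Int.negSucc k) n

/-- The integer `m - n`. -/
def subNatNatRec (m n : ℕ) : ℤ :=
  Nat.rec (motive := fun _ => ℤ) (Int.ofNat (Nat.sub m n)) (fun k _ => Int.negSucc k) (Nat.sub n m)

/-- The product of two integers. -/
def mulRec (a b : ℤ) : ℤ :=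
  Int.rec (motive := fun _ => ℤ)
    (fun m => Int.rec (motive := fun _ => ℤ) (fun n => Int.ofNat (Nat.mul m n))
      (fun n => negOfNatRec (Nat.mul m (Nat.succ n))) b)
    (fun m => Int.rec (motive := fun _ => ℤ) (fun n => negOfNatRec (Nat.mul (Nat.succ m) n))
      (fun n => Int.ofNat (Nat.mul (Nat.succ m) (Nat.succ n))) b) a

/-- The sum of two integers. -/
def addRec (a b : ℤ) : ℤ :=
  Int.rec (motive := fun _ => ℤ)
    (fun m => Int.rec (motive := fun _ => ℤ) (fun n => Int.ofNat (Nat.add m n))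
      (fun n => subNatNatRec m (Nat.succ n)) b)
    (fun m => Int.rec (motive := fun _ => ℤ) (fun n => subNatNatRec n (Nat.succ m))
      (fun n => Int.negSucc (Nat.succ (Nat.add m n))) b) a

theorem negOfNatRec_eq (n : ℕ) : negOfNatRec n = Int.negOfNat n := by
  cases n <;> rfl

theorem subNatNatRec_eq (m n : ℕ) : subNatNatRec m n = Int.subNatNat m n := by
  simp only [subNatNatRec, Int.subNatNat, Nat.sub_eq]
  cases n - m <;> rfl

theorem mulRec_eq (a b : ℤ) : mulRec a b = a * b := by
  cases a <;> cases b <;> first | rfl | exact negOfNatRec_eq _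

theorem addRec_eq (a b : ℤ) : addRec a b = a + b := by
  cases a <;> cases b <;> first | rfl | exact subNatNatRec_eq _ _

/-! ### Taylor models -/

/-- A quadratic polynomial `c₀ + c₁ t + c₂ t²` with integer coefficients, together with an error
radius; it encloses real functions of `t ∈ [-1, 1]`. -/
structure TaylorModel where
  c₀ : ℤ
  c₁ : ℤ
  c₂ : ℤ
  r : ℕ

namespace TaylorModel

/-- The sum of two enclosures. -/
def add (x y : TaylorModel) : TaylorModel :=
  ⟨addRec x.c₀ y.c₀, addRec x.c₁ y.c₁, addRec x.c₂ y.c₂, Nat.add x.r y.r⟩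

/-- The difference of two enclosures. -/
def sub (x y : TaylorModel) : TaylorModel :=
  ⟨x.c₀ - y.c₀, x.c₁ - y.c₁, x.c₂ - y.c₂, x.r + y.r⟩

/-- An integer multiple of an enclosure. -/
def smul (k : ℤ) (x : TaylorModel) : TaylorModel :=
  ⟨mulRec k x.c₀, mulRec k x.c₁, mulRec k x.c₂, Nat.mul k.natAbs x.r⟩

/-- A bound for the absolute value of the polynomial part. -/
def polyBound (x : TaylorModel) : ℕ :=
  x.c₀.natAbs + x.c₁.natAbs + x.c₂.natAbs

/-- A bound for the absolute value of every enclosed function. -/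
def bound (x : TaylorModel) : ℕ :=
  x.polyBound + x.r

/-- The product of two enclosures. -/
def mul (x y : TaylorModel) : TaylorModel :=
  ⟨x.c₀ * y.c₀, x.c₀ * y.c₁ + x.c₁ * y.c₀, x.c₀ * y.c₂ + x.c₁ * y.c₁ + x.c₂ * y.c₀,
    (x.c₁ * y.c₂ + x.c₂ * y.c₁).natAbs + (x.c₂ * y.c₂).natAbs
      + x.polyBound * y.r + y.polyBound * x.r + x.r * y.r⟩

/-- A test which ensures that no enclosed function vanishes. -/
def nonzero (x : TaylorModel) : Bool :=
  Nat.blt (x.c₁.natAbs + x.c₂.natAbs + x.r) x.c₀.natAbs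

end TaylorModel

/-- The line `{(a z + p, b z + q, z)}`, or data attached to its four parameters. -/
structure Quad (α : Type*) where
  a : α
  b : α
  p : α
  q : α

/-- The common denominator of the integer data. -/
def scale : ℤ := 2 ^ 32

/-- Enclosures of the quantities built from two lines which enter the touching equation. -/
structure PairModel where
  u : TaylorModel
  v : TaylorModel
  p : TaylorModel
  q : TaylorModel
  w : TaylorModel
  d : TaylorModel

open TaylorModel in
/-- Enclosures for a pair of lines, from enclosures of the two lines. -/
def pairModel (x y : Quad TaylorModel) : PairModel :=
  let u := sub y.a x.a
  let v := sub y.b x.b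
  let p := sub y.p x.p
  let q := sub y.q x.q
  ⟨u, v, p, q, sub (mul x.a y.b) (mul x.b y.a), sub (mul p v) (mul q u)⟩

open TaylorModel in
/-- An enclosure of the left-hand side of the touching equation. -/
def eqnModel (e : TaylorModel) (x y : Quad TaylorModel) : TaylorModel :=
  let m := pairModel x y
  sub (sub (smul (scale ^ 2) (mul m.d m.d))
    (smul (4 * scale ^ 4) (add (mul m.u m.u) (mul m.v m.v)))) (smul 4 (mul e (mul m.w m.w)))

open TaylorModel in
/-- Enclosures of the slopes of the touching equation with respect to the coordinates of both
lines. -/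
def slopeModel (e : TaylorModel) (x y : Quad TaylorModel) :
    Quad TaylorModel × Quad TaylorModel :=
  let m := pairModel x y
  let k := smul (2 * scale ^ 2) m.d
  let gu := sub (smul (-8 * scale ^ 4) m.u) (mul k m.q)
  let gv := sub (mul k m.p) (smul (8 * scale ^ 4) m.v)
  let gp := mul k m.v
  let gq := smul (-1) (mul k m.u)
  let gw := smul (-8) (mul e m.w)
  (⟨sub (mul gw y.b) gu, smul (-1) (add gv (mul gw y.a)), smul (-1) gp, smul (-1) gq⟩,
    ⟨sub gu (mul gw x.b), add gv (mul gw x.a), gp, gq⟩)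

open TaylorModel in
/-- An enclosure of the scalar product with an integer vector. -/
def dot (g : Quad TaylorModel) (c : Quad ℤ) : TaylorModel :=
  add (add (smul c.a g.a) (smul c.b g.b)) (add (smul c.p g.p) (smul c.q g.q))

/-- A family of lines: `poly` contains the coefficients of quadratic polynomials in `t` for the four
parameters, and `cols` the coefficients of twenty corrections in `[-1, 1]`. -/
structure LineCert where
  poly : Quad (ℤ × ℤ × ℤ)
  cols : List (Quad ℤ)

/-- The enclosure of a family of lines with vanishing corrections. -/
def centerModel (l : LineCert) : Quad TaylorModel :=
  let f : ℤ × ℤ × ℤ → TaylorModel := fun c => ⟨c.1, c.2.1, c.2.2, 0⟩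
  ⟨f l.poly.a, f l.poly.b, f l.poly.p, f l.poly.q⟩

/-- The enclosure of a family of lines with arbitrary corrections in `[-1, 1]`. -/
def boxModel (l : LineCert) : Quad TaylorModel :=
  let f (c : ℤ × ℤ × ℤ) (g : Quad ℤ → ℤ) : TaylorModel :=
    ⟨c.1, c.2.1, c.2.2, (l.cols.map fun x => (g x).natAbs).sum⟩
  ⟨f l.poly.a Quad.a, f l.poly.b Quad.b, f l.poly.p Quad.p, f l.poly.q Quad.q⟩

/-- The test that the two lines are not parallel and that the `n`-th row of the preconditioned
system satisfies the hypotheses of the contraction principle. -/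
def checkPair (e : TaylorModel) (x y : LineCert) (n : ℕ) : Bool :=
  let m := pairModel (boxModel x) (boxModel y)
  let g := slopeModel e (boxModel x) (boxModel y)
  let s := List.zipWith (fun c d => TaylorModel.add (dot g.1 c) (dot g.2 d)) x.cols y.cols
  (m.u.nonzero || m.v.nonzero) &&
    Nat.blt ((eqnModel e (centerModel x) (centerModel y)).bound
      + (s.map TaylorModel.bound).sum) (2 * (s.getD n ⟨0, 0, 0, 0⟩).c₀).toNat

/-- Data which prove that the touching equations are solvable for all parameters in
`[e - h, e + h]`, divided by `scale`: enclosures of the lines other than the two fixed ones. -/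
structure Cert where
  e : ℤ
  h : ℤ
  lines : List LineCert

/-- One of the two lines which span the scissor. -/
def fixedLine (s : ℤ) : LineCert :=
  ⟨⟨(s, 0, 0), (0, 0, 0), (0, 0, 0), (s, 0, 0)⟩, List.replicate 20 ⟨0, 0, 0, 0⟩⟩

/-- All seven lines. -/
def Cert.line (c : Cert) (i : ℕ) : LineCert :=
  (fixedLine (-scale) :: fixedLine scale :: c.lines).getD i (fixedLine 0)

/-- The pairs of lines for which touching is not automatic. -/
def pairs : List (ℕ × ℕ) :=
  [(0, 2), (1, 2), (0, 3), (1, 3), (2, 3), (0, 4), (1, 4), (2, 4), (3, 4),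
    (0, 5), (1, 5), (2, 5), (3, 5), (4, 5), (0, 6), (1, 6), (2, 6), (3, 6), (4, 6), (5, 6)]

/-- The test that a certificate is valid. -/
def Cert.check (c : Cert) : Bool :=
  let e := TaylorModel.mul ⟨c.e, c.h, 0, 0⟩ ⟨c.e, c.h, 0, 0⟩
  c.lines.all (fun l => Nat.beq l.cols.length 20) &&
    (pairs.zipIdx).all fun x => checkPair e (c.line x.1.1) (c.line x.1.2) x.2

namespace TaylorModel

/-- `x.Mem t a` says that `a` is a possible value at `t` of a function enclosed by `x`. -/
def Mem (x : TaylorModel) (t a : ℝ) : Prop :=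
  |a - (x.c₀ + x.c₁ * t + x.c₂ * t ^ 2)| ≤ x.r

variable {x y : TaylorModel} {t a b : ℝ}

theorem Mem.of_eq (ha : x.Mem t a) (hab : b = a) : x.Mem t b := hab ▸ ha

theorem Mem.add (ha : x.Mem t a) (hb : y.Mem t b) : (x.add y).Mem t (a + b) := by
  simp only [Mem, TaylorModel.add, addRec_eq, Nat.add_eq, abs_le] at *
  push_cast
  constructor <;> linarith [ha.1, ha.2, hb.1, hb.2]

theorem Mem.sub (ha : x.Mem t a) (hb : y.Mem t b) : (x.sub y).Mem t (a - b) := by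
  simp only [Mem, TaylorModel.sub, abs_le] at *
  push_cast
  constructor <;> linarith [ha.1, ha.2, hb.1, hb.2]

theorem Mem.smul (k : ℤ) (ha : x.Mem t a) : (x.smul k).Mem t (k * a) := by
  simp only [Mem, TaylorModel.smul, mulRec_eq, Nat.mul_eq] at *
  push_cast
  rw [show (k : ℝ) * a - (k * x.c₀ + k * x.c₁ * t + k * x.c₂ * t ^ 2)
    = k * (a - (x.c₀ + x.c₁ * t + x.c₂ * t ^ 2)) by ring, abs_mul, Nat.cast_natAbs, Int.cast_abs]
  gcongr

theorem Mem.average (ha : x.Mem t a) (hb : x.Mem t b) : x.Mem t ((a + b) / 2) := by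
  simp only [Mem, abs_le] at *
  constructor <;> linarith [ha.1, ha.2, hb.1, hb.2]

theorem abs_poly_le (x : TaylorModel) (ht : |t| ≤ 1) :
    |(x.c₀ : ℝ) + x.c₁ * t + x.c₂ * t ^ 2| ≤ x.polyBound := by
  have h₁ : |(x.c₁ : ℝ) * t| ≤ |(x.c₁ : ℝ)| := by
    rw [abs_mul]; exact mul_le_of_le_one_right (abs_nonneg _) ht
  have h₂ : |(x.c₂ : ℝ) * t ^ 2| ≤ |(x.c₂ : ℝ)| := by
    rw [abs_mul, abs_pow]
    exact mul_le_of_le_one_right (abs_nonneg _) (pow_le_one₀ (abs_nonneg _) ht)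
  simp only [polyBound, Nat.cast_add, Nat.cast_natAbs, Int.cast_abs]
  exact (abs_add_three _ _ _).trans (by linarith)

theorem Mem.abs_le_bound (ht : |t| ≤ 1) (ha : x.Mem t a) : |a| ≤ x.bound := by
  have h := abs_add_le (a - (x.c₀ + x.c₁ * t + x.c₂ * t ^ 2)) (x.c₀ + x.c₁ * t + x.c₂ * t ^ 2)
  rw [sub_add_cancel] at h
  simp only [Mem, bound, Nat.cast_add] at *
  linarith [x.abs_poly_le ht]

theorem Mem.abs_sub_le_bound (ht : |t| ≤ 1) (ha : x.Mem t a) (hx : 0 ≤ x.c₀) :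
    |x.c₀ - a| ≤ x.bound - x.c₀ := by
  have h := (⟨0, x.c₁, x.c₂, x.r⟩ : TaylorModel).abs_poly_le ht
  have h' := abs_add_le (a - (x.c₀ + x.c₁ * t + x.c₂ * t ^ 2)) (0 + x.c₁ * t + x.c₂ * t ^ 2)
  have hx' : |(x.c₀ : ℝ)| = x.c₀ := abs_of_nonneg (mod_cast hx)
  rw [abs_sub_comm]
  simp only [Mem, bound, polyBound, Nat.cast_add, Nat.cast_natAbs, Int.cast_abs, Int.cast_zero,
    abs_zero, hx'] at *
  rw [show a - x.c₀ = a - (x.c₀ + x.c₁ * t + x.c₂ * t ^ 2) + (0 + x.c₁ * t + x.c₂ * t ^ 2) by ring]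
  linarith

theorem Mem.ne_zero (ht : |t| ≤ 1) (ha : x.Mem t a) (hx : x.nonzero = true) : a ≠ 0 := by
  rintro rfl
  have h := (⟨0, x.c₁, x.c₂, 0⟩ : TaylorModel).abs_poly_le ht
  have h' := abs_add_le ((x.c₀ : ℝ) + x.c₁ * t + x.c₂ * t ^ 2) (-(0 + x.c₁ * t + x.c₂ * t ^ 2))
  have hx' : (((x.c₁.natAbs + x.c₂.natAbs + x.r : ℕ)) : ℝ) < x.c₀.natAbs := by
    exact_mod_cast Nat.blt_eq.mp hx
  rw [abs_neg] at h'
  simp only [Mem, polyBound, Nat.cast_add, Nat.cast_natAbs, Int.cast_abs, Int.cast_zero,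
    abs_zero, zero_sub, abs_neg] at *
  rw [show (x.c₀ : ℝ) + x.c₁ * t + x.c₂ * t ^ 2 + -(0 + x.c₁ * t + x.c₂ * t ^ 2) = x.c₀ by ring]
    at h'
  linarith

theorem Mem.mul (ht : |t| ≤ 1) (ha : x.Mem t a) (hb : y.Mem t b) : (x.mul y).Mem t (a * b) := by
  have hx := x.abs_poly_le ht
  have hy := y.abs_poly_le ht
  simp only [Mem, TaylorModel.mul] at *
  set X := (x.c₀ : ℝ) + x.c₁ * t + x.c₂ * t ^ 2 with hX
  set Y := (y.c₀ : ℝ) + y.c₁ * t + y.c₂ * t ^ 2 with hY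
  have h₃ : |((x.c₁ * y.c₂ + x.c₂ * y.c₁ : ℤ) : ℝ) * t ^ 3|
      ≤ ((x.c₁ * y.c₂ + x.c₂ * y.c₁).natAbs : ℝ) := by
    rw [abs_mul, abs_pow, Nat.cast_natAbs, Int.cast_abs]
    exact mul_le_of_le_one_right (abs_nonneg _) (pow_le_one₀ (abs_nonneg _) ht)
  have h₄ : |((x.c₂ * y.c₂ : ℤ) : ℝ) * t ^ 4| ≤ ((x.c₂ * y.c₂).natAbs : ℝ) := by
    rw [abs_mul, abs_pow, Nat.cast_natAbs, Int.cast_abs]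
    exact mul_le_of_le_one_right (abs_nonneg _) (pow_le_one₀ (abs_nonneg _) ht)
  have h₅ : |X * (b - Y)| ≤ x.polyBound * y.r := by rw [abs_mul]; gcongr
  have h₆ : |Y * (a - X)| ≤ y.polyBound * x.r := by rw [abs_mul]; gcongr
  have h₇ : |(a - X) * (b - Y)| ≤ x.r * y.r := by rw [abs_mul]; gcongr
  have key : a * b - (((x.c₀ * y.c₀ : ℤ) : ℝ) + ((x.c₀ * y.c₁ + x.c₁ * y.c₀ : ℤ) : ℝ) * t
      + ((x.c₀ * y.c₂ + x.c₁ * y.c₁ + x.c₂ * y.c₀ : ℤ) : ℝ) * t ^ 2)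
      = ((x.c₁ * y.c₂ + x.c₂ * y.c₁ : ℤ) : ℝ) * t ^ 3 + ((x.c₂ * y.c₂ : ℤ) : ℝ) * t ^ 4
        + X * (b - Y) + Y * (a - X) + (a - X) * (b - Y) := by
    rw [hX, hY]; push_cast; ring
  rw [key]
  push_cast only [Nat.cast_add, Nat.cast_mul]
  rw [abs_le] at *
  constructor <;> linarith [h₃.1, h₃.2, h₄.1, h₄.2, h₅.1, h₅.2, h₆.1, h₆.2, h₇.1, h₇.2]

end TaylorModel

/-- The componentwise version of `TaylorModel.Mem`. -/
structure Quad.Mem (m : Quad TaylorModel) (t : ℝ) (x : Quad ℝ) : Prop where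
  a : m.a.Mem t x.a
  b : m.b.Mem t x.b
  p : m.p.Mem t x.p
  q : m.q.Mem t x.q

/-- The determinant of the direction vectors and the difference of the base points of two lines,
up to normalisation. -/
def separation (x y : Quad ℝ) : ℝ :=
  (y.p - x.p) * (y.b - x.b) - (y.q - x.q) * (y.a - x.a)

/-- The left-hand side of the touching equation, in scaled coordinates. -/
def touching (e : ℝ) (x y : Quad ℝ) : ℝ :=
  (scale : ℝ) ^ 2 * separation x y ^ 2
    - 4 * (scale : ℝ) ^ 4 * ((y.a - x.a) ^ 2 + (y.b - x.b) ^ 2)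
    - 4 * (e * (x.a * y.b - x.b * y.a) ^ 2)

/-- The scalar product of two coordinate quadruples. -/
def pairing (g x : Quad ℝ) : ℝ :=
  g.a * x.a + g.b * x.b + (g.p * x.p + g.q * x.q)

section Soundness

variable {m n E : Quad TaylorModel} {k : TaylorModel} {t e : ℝ} {x y x' y' : Quad ℝ}

open TaylorModel

/-- Membership of the quantities attached to two lines in their enclosures. -/
structure PairModel.Mem (m : PairModel) (t : ℝ) (x y : Quad ℝ) : Prop where
  u : m.u.Mem t (y.a - x.a)
  v : m.v.Mem t (y.b - x.b)
  p : m.p.Mem t (y.p - x.p)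
  q : m.q.Mem t (y.q - x.q)
  w : m.w.Mem t (x.a * y.b - x.b * y.a)
  d : m.d.Mem t (separation x y)

theorem pairModel_mem (ht : |t| ≤ 1) (hx : m.Mem t x) (hy : n.Mem t y) :
    (pairModel m n).Mem t x y where
  u := hy.a.sub hx.a
  v := hy.b.sub hx.b
  p := hy.p.sub hx.p
  q := hy.q.sub hx.q
  w := (hx.a.mul ht hy.b).sub (hx.b.mul ht hy.a)
  d := ((hy.p.sub hx.p).mul ht (hy.b.sub hx.b)).sub ((hy.q.sub hx.q).mul ht (hy.a.sub hx.a))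

theorem eqnModel_mem (ht : |t| ≤ 1) (he : k.Mem t e) (hx : m.Mem t x) (hy : n.Mem t y) :
    (eqnModel k m n).Mem t (touching e x y) := by
  have h := pairModel_mem ht hx hy
  have := (((h.d.mul ht h.d).smul (scale ^ 2)).sub
    (((h.u.mul ht h.u).add (h.v.mul ht h.v)).smul (4 * scale ^ 4))).sub
    ((he.mul ht (h.w.mul ht h.w)).smul 4)
  refine this.of_eq ?_
  simp only [touching]
  push_cast
  ring

theorem exists_slope (ht : |t| ≤ 1) (he : k.Mem t e) (hx : m.Mem t x) (hy : n.Mem t y)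
    (hx' : m.Mem t x') (hy' : n.Mem t y') :
    ∃ g g' : Quad ℝ, (slopeModel k m n).1.Mem t g ∧ (slopeModel k m n).2.Mem t g' ∧
      touching e x y - touching e x' y' =
        pairing g ⟨x.a - x'.a, x.b - x'.b, x.p - x'.p, x.q - x'.q⟩ +
        pairing g' ⟨y.a - y'.a, y.b - y'.b, y.p - y'.p, y.q - y'.q⟩ := by
  have h := pairModel_mem ht hx hy
  have h' := pairModel_mem ht hx' hy'
  have hk := (h.d.average h'.d).smul (2 * scale ^ 2)
  have hgu := ((h.u.average h'.u).smul (-8 * scale ^ 4)).sub (hk.mul ht (h.q.average h'.q))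
  have hgv := (hk.mul ht (h.p.average h'.p)).sub ((h.v.average h'.v).smul (8 * scale ^ 4))
  have hgp := hk.mul ht (h.v.average h'.v)
  have hgq := (hk.mul ht (h.u.average h'.u)).smul (-1)
  have hgw := (he.mul ht (h.w.average h'.w)).smul (-8)
  refine ⟨⟨_, _, _, _⟩, ⟨_, _, _, _⟩,
    ⟨(hgw.mul ht (hy.b.average hy'.b)).sub hgu,
      (hgv.add (hgw.mul ht (hy.a.average hy'.a))).smul (-1), hgp.smul (-1), hgq.smul (-1)⟩,
    ⟨hgu.sub (hgw.mul ht (hx.b.average hx'.b)), hgv.add (hgw.mul ht (hx.a.average hx'.a)),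
      hgp, hgq⟩, ?_⟩
  simp only [touching, separation, pairing]
  push_cast
  ring

theorem dot_mem (hx : m.Mem t x) (c : Quad ℤ) :
    (dot m c).Mem t (pairing x ⟨c.a, c.b, c.p, c.q⟩) := by
  have := ((hx.a.smul c.a).add (hx.b.smul c.b)).add ((hx.p.smul c.p).add (hx.q.smul c.q))
  refine this.of_eq ?_
  simp only [pairing]
  ring

end Soundness

/-- A zero of a map close to a diagonal linear map, by the contraction principle. -/
theorem exists_zero_of_near_diagonal {ι : Type*} [Fintype ι] (F : ι → (ι → ℝ) → ℝ)
    (c B : ι → ℝ) (hc : ∀ i, 0 < c i) (hB : ∀ i, 0 ≤ B i)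
    (hF : ∀ i, ∀ y ∈ Metric.closedBall (0 : ι → ℝ) 1, ∀ z ∈ Metric.closedBall (0 : ι → ℝ) 1,
      |c i * (y i - z i) - (F i y - F i z)| ≤ B i * ‖y - z‖)
    (h0 : ∀ i, |F i 0| + B i < c i) :
    ∃ y ∈ Metric.closedBall (0 : ι → ℝ) 1, ∀ i, F i y = 0 := by
  set s := Metric.closedBall (0 : ι → ℝ) 1 with hs
  obtain ⟨K, hK, hBK⟩ : ∃ K : NNReal, K < 1 ∧ ∀ i, B i ≤ K * c i := by
    refine ⟨Finset.univ.sup fun i => (B i / c i).toNNReal, ?_, fun i => ?_⟩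
    · rw [Finset.sup_lt_iff (by simp)]
      intro i _
      rw [Real.toNNReal_lt_one, div_lt_one (hc i)]
      linarith [h0 i, abs_nonneg (F i 0)]
    · rw [← div_le_iff₀ (hc i)]
      refine (Real.le_coe_toNNReal _).trans ?_
      exact_mod_cast Finset.le_sup (f := fun i => (B i / c i).toNNReal) (Finset.mem_univ i)
  let T : (ι → ℝ) → ι → ℝ := fun y i => y i - F i y / c i
  have hT : ∀ i, ∀ y ∈ s, ∀ z ∈ s, |T y i - T z i| ≤ B i / c i * ‖y - z‖ := by
    intro i y hy z hz
    have : T y i - T z i = (c i * (y i - z i) - (F i y - F i z)) / c i := by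
      have := (hc i).ne'
      simp only [T]
      field_simp
      ring
    rw [this, abs_div, abs_of_pos (hc i), div_mul_eq_mul_div]
    gcongr
    · exact (hc i).le
    · exact hF i y hy z hz
  have h0s : (0 : ι → ℝ) ∈ s := by simp [hs]
  have hmaps : Set.MapsTo T s s := by
    intro y hy
    rw [hs, mem_closedBall_zero_iff, pi_norm_le_iff_of_nonneg zero_le_one]
    intro i
    have hy' : ‖y‖ ≤ 1 := mem_closedBall_zero_iff.1 hy
    have h1 := hF i y hy 0 h0s
    have h2 : T y i = (c i * (y i - (0 : ι → ℝ) i) - (F i y - F i 0) - F i 0) / c i := by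
      have := (hc i).ne'
      simp only [T, Pi.zero_apply]
      field_simp
      ring
    rw [Real.norm_eq_abs, h2, abs_div, abs_of_pos (hc i), div_le_one (hc i)]
    rw [sub_zero] at h1
    have := mul_le_of_le_one_right (hB i) hy'
    have h3 := abs_sub (c i * (y i - (0 : ι → ℝ) i) - (F i y - F i 0)) (F i 0)
    linarith [h0 i]
  have hlip : ContractingWith K (hmaps.restrict T s s) := by
    refine ⟨hK, LipschitzWith.of_dist_le_mul fun y z => ?_⟩
    rw [Subtype.dist_eq, Subtype.dist_eq, dist_eq_norm, dist_eq_norm,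
      pi_norm_le_iff_of_nonneg (by positivity)]
    intro i
    refine (hT i y y.2 z z.2).trans ?_
    gcongr
    exact (div_le_iff₀ (hc i)).2 (hBK i)
  obtain ⟨y, hy, hfix, -⟩ := hlip.exists_fixedPoint' Metric.isClosed_closedBall.isComplete hmaps h0s
    (edist_ne_top _ _)
  refine ⟨y, hy, fun i => ?_⟩
  have h1 : y i - F i y / c i = y i := congrFun hfix i
  rw [sub_eq_self, div_eq_zero_iff] at h1
  exact h1.resolve_right (hc i).ne'

theorem List.sum_map_eq_sum_getD {α M : Type*} [AddCommMonoid M] (l : List α) (d : α) (f : α → M)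
    {n : ℕ} (hn : l.length = n) : (l.map f).sum = ∑ j : Fin n, f (l.getD j d) := by
  subst hn
  induction l with
  | nil => simp
  | cons a l ih =>
    rw [List.map_cons, List.sum_cons, ih]
    exact (Fin.sum_univ_succ fun j : Fin (l.length + 1) => f ((a :: l).getD j d)).symm

/-- The point of the enclosed family with parameter `t` and correction vector `y`. -/
def LineCert.eval (l : LineCert) (t : ℝ) (y : Fin 20 → ℝ) : Quad ℝ :=
  let f (c : ℤ × ℤ × ℤ) (g : Quad ℤ → ℤ) : ℝ :=
    (c.1 + c.2.1 * t + c.2.2 * t ^ 2) +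
      ∑ j : Fin 20, (g (l.cols.getD j ⟨0, 0, 0, 0⟩) : ℝ) * y j
  ⟨f l.poly.a Quad.a, f l.poly.b Quad.b, f l.poly.p Quad.p, f l.poly.q Quad.q⟩

section Certificates

variable {t e : ℝ} {l l' : LineCert} {k : TaylorModel} {y z : Fin 20 → ℝ}

theorem centerModel_mem (l : LineCert) (t : ℝ) : (centerModel l).Mem t (l.eval t 0) := by
  constructor <;> simp [TaylorModel.Mem, centerModel, LineCert.eval]

theorem boxModel_mem (hl : l.cols.length = 20) (hy : y ∈ Metric.closedBall (0 : Fin 20 → ℝ) 1) :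
    (boxModel l).Mem t (l.eval t y) := by
  have hy' : ∀ j, |y j| ≤ 1 := fun j =>
    (norm_le_pi_norm y j).trans (mem_closedBall_zero_iff.1 hy)
  have key (g : Quad ℤ → ℤ) : |∑ j : Fin 20, (g (l.cols.getD j ⟨0, 0, 0, 0⟩) : ℝ) * y j|
      ≤ ((l.cols.map fun x => (g x).natAbs).sum : ℕ) := by
    rw [List.sum_map_eq_sum_getD _ ⟨0, 0, 0, 0⟩ _ hl, Nat.cast_sum]
    refine (Finset.abs_sum_le_sum_abs _ _).trans (Finset.sum_le_sum fun j _ => ?_)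
    rw [abs_mul, Nat.cast_natAbs, Int.cast_abs]
    exact mul_le_of_le_one_right (abs_nonneg _) (hy' j)
  constructor <;> simpa only [TaylorModel.Mem, boxModel, LineCert.eval, add_sub_cancel_left]
    using key _

/-- The enclosures of the partial slopes of the touching equation. -/
def slopes (k : TaylorModel) (l l' : LineCert) : List TaylorModel :=
  let g := slopeModel k (boxModel l) (boxModel l')
  List.zipWith (fun c d => TaylorModel.add (dot g.1 c) (dot g.2 d)) l.cols l'.cols

theorem length_slopes (hl : l.cols.length = 20) (hl' : l'.cols.length = 20) :
    (slopes k l l').length = 20 := by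
  simp [slopes, hl, hl']

theorem pairing_eval_sub (g : Quad ℝ) (l : LineCert) (t : ℝ) (y z : Fin 20 → ℝ) :
    pairing g ⟨(l.eval t y).a - (l.eval t z).a, (l.eval t y).b - (l.eval t z).b,
      (l.eval t y).p - (l.eval t z).p, (l.eval t y).q - (l.eval t z).q⟩ =
    ∑ j : Fin 20, (let c := l.cols.getD j ⟨0, 0, 0, 0⟩; pairing g ⟨c.a, c.b, c.p, c.q⟩) *
      (y j - z j) := by
  simp only [pairing, LineCert.eval, add_sub_add_left_eq_sub, ← Finset.sum_sub_distrib,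
    Finset.mul_sum, ← Finset.sum_add_distrib]
  exact Finset.sum_congr rfl fun j _ => by ring

theorem exists_slopes (ht : |t| ≤ 1) (he : k.Mem t e) (hl : l.cols.length = 20)
    (hl' : l'.cols.length = 20) (hy : y ∈ Metric.closedBall (0 : Fin 20 → ℝ) 1)
    (hz : z ∈ Metric.closedBall (0 : Fin 20 → ℝ) 1) :
    ∃ m : Fin 20 → ℝ, (∀ j : Fin 20, ((slopes k l l').getD j ⟨0, 0, 0, 0⟩).Mem t (m j)) ∧
      touching e (l.eval t y) (l'.eval t y) - touching e (l.eval t z) (l'.eval t z) =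
        ∑ j, m j * (y j - z j) := by
  obtain ⟨g, g', hg, hg', h⟩ := exists_slope ht he (boxModel_mem hl hy) (boxModel_mem hl' hy)
    (boxModel_mem hl hz) (boxModel_mem hl' hz)
  rw [pairing_eval_sub, pairing_eval_sub, ← Finset.sum_add_distrib] at h
  simp only [← add_mul] at h
  refine ⟨_, fun j => ?_, h⟩
  have hj := j.2
  have h1 : (slopes k l l').getD j ⟨0, 0, 0, 0⟩ =
      let g := slopeModel k (boxModel l) (boxModel l')
      TaylorModel.add (dot g.1 (l.cols.getD j ⟨0, 0, 0, 0⟩))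
        (dot g.2 (l'.cols.getD j ⟨0, 0, 0, 0⟩)) := by
    simp [slopes, hl, hl']
  rw [h1]
  exact (dot_mem hg _).add (dot_mem hg' _)

theorem checkPair_sound {n : Fin 20} (ht : |t| ≤ 1) (he : k.Mem t e) (hl : l.cols.length = 20)
    (hl' : l'.cols.length = 20) (h : checkPair k l l' n = true) :
    (∀ y ∈ Metric.closedBall (0 : Fin 20 → ℝ) 1,
      (l'.eval t y).a - (l.eval t y).a ≠ 0 ∨ (l'.eval t y).b - (l.eval t y).b ≠ 0) ∧
    ∃ c B : ℝ, 0 < c ∧ 0 ≤ B ∧ |touching e (l.eval t 0) (l'.eval t 0)| + B < c ∧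
      ∀ y ∈ Metric.closedBall (0 : Fin 20 → ℝ) 1, ∀ z ∈ Metric.closedBall (0 : Fin 20 → ℝ) 1,
        |c * (y n - z n) - (touching e (l.eval t y) (l'.eval t y)
          - touching e (l.eval t z) (l'.eval t z))| ≤ B * ‖y - z‖ := by
  have h' : ((pairModel (boxModel l) (boxModel l')).u.nonzero ||
      (pairModel (boxModel l) (boxModel l')).v.nonzero) = true ∧
      (eqnModel k (centerModel l) (centerModel l')).bound
        + ((slopes k l l').map TaylorModel.bound).sum
        < (2 * ((slopes k l l').getD n ⟨0, 0, 0, 0⟩).c₀).toNat := by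
    rw [← Nat.blt_eq, ← Bool.and_eq_true]
    exact h
  obtain ⟨hsep, hlt⟩ := h'
  refine ⟨fun y hy => ?_, ?_⟩
  · have hm := pairModel_mem ht (boxModel_mem hl hy) (boxModel_mem hl' hy)
    rcases Bool.or_eq_true_iff.1 hsep with hu | hv
    · exact Or.inl (hm.u.ne_zero ht hu)
    · exact Or.inr (hm.v.ne_zero ht hv)
  rw [List.sum_map_eq_sum_getD _ ⟨0, 0, 0, 0⟩ _ (length_slopes hl hl')] at hlt
  set s : Fin 20 → TaylorModel := fun j => (slopes k l l').getD j ⟨0, 0, 0, 0⟩ with hs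
  change _ + ∑ j, (s j).bound < (2 * (s n).c₀).toNat at hlt
  have hc : 0 < (s n).c₀ := by lia
  have hlt' : ((eqnModel k (centerModel l) (centerModel l')).bound : ℝ)
      + ∑ j, ((s j).bound : ℝ) < 2 * (s n).c₀ := by
    have : (((eqnModel k (centerModel l) (centerModel l')).bound + ∑ j, (s j).bound : ℕ) : ℤ)
        < 2 * (s n).c₀ := by lia
    exact_mod_cast this
  have hcn : ((s n).c₀ : ℝ) ≤ (s n).bound := by
    have : (s n).c₀ ≤ (s n).bound := by simp only [TaylorModel.bound, TaylorModel.polyBound]; lia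
    exact_mod_cast this
  have hsum := Finset.add_sum_erase Finset.univ (fun j => ((s j).bound : ℝ)) (Finset.mem_univ n)
  have hnn : 0 ≤ ∑ j ∈ Finset.univ.erase n, ((s j).bound : ℝ) :=
    Finset.sum_nonneg fun j _ => Nat.cast_nonneg _
  refine ⟨(s n).c₀, ∑ j, ((s j).bound : ℝ) - (s n).c₀, mod_cast hc, by linarith, ?_,
    fun y hy z hz => ?_⟩
  · have := (eqnModel_mem ht he (centerModel_mem l t) (centerModel_mem l' t)).abs_le_bound ht
    linarith
  · obtain ⟨m, hm, heq⟩ := exists_slopes ht he hl hl' hy hz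
    have hyz : ∀ j, |y j - z j| ≤ ‖y - z‖ := fun j => norm_le_pi_norm (y - z) j
    have hrest : |∑ j ∈ Finset.univ.erase n, m j * (y j - z j)|
        ≤ (∑ j ∈ Finset.univ.erase n, ((s j).bound : ℝ)) * ‖y - z‖ := by
      rw [Finset.sum_mul]
      refine (Finset.abs_sum_le_sum_abs _ _).trans (Finset.sum_le_sum fun j _ => ?_)
      rw [abs_mul]
      exact mul_le_mul ((hm j).abs_le_bound ht) (hyz j) (abs_nonneg _) (Nat.cast_nonneg _)
    have hdiag : |((s n).c₀ - m n) * (y n - z n)| ≤ ((s n).bound - (s n).c₀) * ‖y - z‖ := by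
      rw [abs_mul]
      exact mul_le_mul ((hm n).abs_sub_le_bound ht hc.le) (hyz n) (abs_nonneg _) (by linarith)
    rw [heq, ← Finset.add_sum_erase _ _ (Finset.mem_univ n),
      show (s n).c₀ * (y n - z n) - (m n * (y n - z n)
          + ∑ j ∈ Finset.univ.erase n, m j * (y j - z j))
        = ((s n).c₀ - m n) * (y n - z n) - ∑ j ∈ Finset.univ.erase n, m j * (y j - z j) by ring]
    refine (abs_sub _ _).trans ?_
    rw [← hsum]
    linarith

theorem Cert.length_cols {c : Cert} (h : c.check = true) (i : ℕ) : (c.line i).cols.length = 20 := by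
  simp only [Cert.check, Bool.and_eq_true, List.all_eq_true, Nat.beq_eq] at h
  have hmem : ∀ l ∈ fixedLine (-scale) :: fixedLine scale :: c.lines, l.cols.length = 20 := by
    simpa [fixedLine] using h.1
  rw [Cert.line, List.getD_eq_getElem?_getD]
  rcases hi : (fixedLine (-scale) :: fixedLine scale :: c.lines)[i]? with _ | l
  · rfl
  · exact hmem l (List.mem_of_getElem? hi)

theorem eval_fixedLine (s : ℤ) (t : ℝ) (y : Fin 20 → ℝ) :
    (fixedLine s).eval t y = ⟨s, 0, 0, s⟩ := by
  simp [LineCert.eval, fixedLine, -List.reduceReplicate]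

theorem Cert.exists_touching {c : Cert} (h : c.check = true) (ht : |t| ≤ 1) :
    ∃ x : ℕ → Quad ℝ, x 0 = ⟨-scale, 0, 0, -scale⟩ ∧ x 1 = ⟨scale, 0, 0, scale⟩ ∧
      ∀ i ∈ pairs, ((x i.2).a - (x i.1).a ≠ 0 ∨ (x i.2).b - (x i.1).b ≠ 0) ∧
        touching ((c.e + c.h * t) ^ 2) (x i.1) (x i.2) = 0 := by
  have hlen := c.length_cols h
  have he : (TaylorModel.mul ⟨c.e, c.h, 0, 0⟩ ⟨c.e, c.h, 0, 0⟩).Mem t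
      ((c.e + c.h * t) ^ 2) := by
    rw [sq]
    refine TaylorModel.Mem.mul ht ?_ ?_ <;> simp [TaylorModel.Mem]
  have hpair : ∀ n : Fin 20, _ := fun n =>
    checkPair_sound (n := n) ht he (hlen (pairs[n]).1) (hlen (pairs[n]).2) (by
      simp only [Cert.check, Bool.and_eq_true, List.all_eq_true] at h
      exact h.2 (pairs[n], n) (List.mem_zipIdx_iff_getElem?.2 (by simp)))
  choose hsep C B hC hB h0 hF using hpair
  obtain ⟨y, hy, hzero⟩ := exists_zero_of_near_diagonal
    (fun (n : Fin 20) y => touching ((c.e + c.h * t) ^ 2) ((c.line (pairs[n]).1).eval t y)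
      ((c.line (pairs[n]).2).eval t y)) C B hC hB hF h0
  refine ⟨fun i => (c.line i).eval t y, ?_, ?_, fun i hi => ?_⟩
  · exact (eval_fixedLine (-scale) t y).trans (by push_cast; rfl)
  · exact eval_fixedLine scale t y
  · obtain ⟨n, hn, rfl⟩ := List.getElem_of_mem hi
    exact ⟨hsep ⟨n, hn⟩ y hy, hzero ⟨n, hn⟩⟩

end Certificates

/-- A test which ensures that every `s ∈ (0, hi]` lies in the parameter interval of one of the
certificates. -/
def covers : ℤ → List Cert → Bool
  | hi, [] => decide (hi ≤ 0)
  | hi, c :: cs => decide (0 < c.h) && decide (hi ≤ c.e + c.h) && covers (c.e - c.h) cs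

theorem exists_mem_of_covers {l : List Cert} {hi : ℤ} (h : covers hi l = true) {s : ℝ}
    (hs : 0 < s) (hs' : s ≤ hi) : ∃ c ∈ l, ∃ t : ℝ, |t| ≤ 1 ∧ c.e + c.h * t = s := by
  induction l generalizing hi with
  | nil =>
    have : (hi : ℝ) ≤ 0 := by exact_mod_cast of_decide_eq_true h
    linarith
  | cons c cs ih =>
    simp only [covers, Bool.and_eq_true, decide_eq_true_eq] at h
    obtain ⟨⟨hpos, hhi⟩, hcs⟩ := h
    by_cases hc : s ≤ c.e - c.h
    · obtain ⟨c', hc', ht⟩ := ih hcs (by exact_mod_cast hc)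
      exact ⟨c', List.mem_cons_of_mem _ hc', ht⟩
    · have hpos' : (0 : ℝ) < c.h := by exact_mod_cast hpos
      have hhi' : (hi : ℝ) ≤ c.e + c.h := by exact_mod_cast hhi
      refine ⟨c, List.mem_cons_self, (s - c.e) / c.h, ?_, by field_simp; ring⟩
      rw [abs_le, le_div_iff₀ hpos', div_le_iff₀ hpos']
      constructor <;> linarith

def box0 : Cert :=
  ⟨4170344525, 124622774, [⟨⟨(2012863124, -18546016, 113385), (-971355634, 4937339, 75241),
    (-12745322823, -133341951, -1002891), (-11117868760, 11545930, -109250)⟩, [⟨9054, 486, 26016,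
    -16751⟩, ⟨-11376, 1767, -870, 109⟩, ⟨5005, 1638, 271, -3950⟩, ⟨-2134, -758, 891, 1625⟩, ⟨-1681,
    -263, -4990, 1615⟩, ⟨14860, 10292, -91758, -6279⟩, ⟨-24931, 2279, -179376, 30153⟩, ⟨-132205,
    -18184, -435019, 129514⟩, ⟨74051, 24792, -5408, -57883⟩, ⟨-15968, -3961, -22451, 13872⟩, ⟨6333,
    1463, 10753, -5611⟩, ⟨-18082, -4613, -23249, 15580⟩, ⟨-623, -538, 5660, 156⟩, ⟨126562, 31032,
    184127, -110311⟩, ⟨-4589, -1491, -440, 3632⟩, ⟨-6429, -1652, -8068, 5528⟩, ⟨17980, 4199, 29730,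
    -15882⟩, ⟨15176, 4770, 4189, -12174⟩, ⟨-109069, -32336, -63299, 89450⟩, ⟨16196, 4185, 19912,
    -13901⟩]⟩, ⟨⟨(788052857, -21527370, 192102), (548924753, -2122316, -32131), (-33603599882,
    -211493859, -1519526), (762820584, -21316134, 196437)⟩, [⟨9654, -466, -745, 9366⟩, ⟨-13819,
    177, -26955, -13364⟩, ⟨5046, 355, -28172, 14550⟩, ⟨-5212, 2197, 8793, -16327⟩, ⟨11086, 234,
    43145, 10686⟩, ⟨21918, -4063, -173341, 21534⟩, ⟨-19462, -793, -97515, -18727⟩, ⟨-130010, 7581,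
    84266, -126254⟩, ⟨85757, -9932, -337378, 83721⟩, ⟨-18105, 1471, 35465, -17619⟩, ⟨5096, -853,
    -35064, 4999⟩, ⟨-22954, 1349, 15466, -22291⟩, ⟨-8077, -896, -72854, -7721⟩, ⟨136526, -12561,
    -351335, 132993⟩, ⟨-4443, 728, 29669, -4357⟩, ⟨-8622, 413, 482, -8365⟩, ⟨26418, -573, 38161,
    25568⟩, ⟨15574, -2185, -83055, 15239⟩, ⟨-122608, 13002, 413893, -119590⟩, ⟨21588, -1075, -3495,
    20947⟩]⟩, ⟨⟨(-6642461733, 78268781, -1288965), (4594065530, -80165324, 1156013), (-15349877002,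
    -74301836, -2954357), (788585122, -45850911, 1233690)⟩, [⟨-31023, 25074, -47243, 30085⟩,
    ⟨30992, -33926, 41999, -35421⟩, ⟨-42815, 27090, -69601, 36978⟩, ⟨24201, -18703, 37357, -22951⟩,
    ⟨-14557, 25704, -14008, 22542⟩, ⟨2348, -5123, -357341, 146577⟩, ⟨20095, -16526, 89768,
    -135774⟩, ⟨453322, -342885, 704109, -425405⟩, ⟨-689122, 467758, -1101667, 614357⟩, ⟨60172,
    -41094, 96048, -53796⟩, ⟨-13509, 4356, -24414, 9134⟩, ⟨80317, -60578, 124850, -75267⟩, ⟨38960,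
    -43823, 52110, -45238⟩, ⟨-442275, 285759, -715501, 385559⟩, ⟨35396, -17712, 60283, -27740⟩,
    ⟨30156, -23856, 46227, -28932⟩, ⟨-65648, 65795, -92516, 71361⟩, ⟨-109937, 58226, -185349,
    88099⟩, ⟨703530, -414193, 1161785, -588912⟩, ⟨-77047, 60150, -118574, 73434⟩]⟩, ⟨⟨(1988148480,
    -10366288, 198340), (-2657116844, 5890459, 150901), (-22104269738, -192532761, -1295309),
    (-4918315394, 40292734, -554377)⟩, [⟨9400, 2356, 17594, -23587⟩, ⟨-4146, 293, -14299, 9771⟩,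
    ⟨5978, 5172, -6840, -16746⟩, ⟨-2175, -1935, 2749, 6118⟩, ⟨-3824, -3051, 3108, 10591⟩, ⟨17127,
    33337, -110460, -56782⟩, ⟨-28436, 12034, -147241, 62248⟩, ⟨-151253, -41437, -265787, 381216⟩,
    ⟨84942, 73996, -99632, -238198⟩, ⟨-17773, -13828, -4129, 29637⟩, ⟨12189, -2484, -12882, -1364⟩,
    ⟨-26900, -7393, -47154, 67808⟩, ⟨1368, 884, -92, -3691⟩, ⟨145004, 87039, 22647, -387954⟩,
    ⟨-6211, -5631, 8366, 17521⟩, ⟨-5517, -2335, -5656, 14297⟩, ⟨12368, 1188, 32529, -30126⟩,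
    ⟨19373, 16585, -21296, -54188⟩, ⟨-125046, -94456, 75645, 343779⟩, ⟨14076, 6190, 13284,
    -36585⟩]⟩, ⟨⟨(556308871, -15022749, 218642), (-446991526, 2166731, 21714), (-40802619195,
    -233187825, -2059784), (8125028061, 16695729, -210855)⟩, [⟨9251, 263, -4606, -9308⟩, ⟨-8537,
    330, -47470, 8356⟩, ⟨5896, 566, -38860, -6094⟩, ⟨-3585, -114, 2886, 3612⟩, ⟨3234, -808, 79604,
    -2888⟩, ⟨26980, 2950, -210512, -28032⟩, ⟨-17835, 599, -91012, 17494⟩, ⟨-137054, -5414, 205255,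
    138508⟩, ⟨97263, 7179, -446887, -99652⟩, ⟨-19685, -1060, 54939, 20009⟩, ⟨6103, 615, -42910,
    -6320⟩, ⟨-24296, -971, 37374, 24558⟩, ⟨-6795, 648, -72527, 6494⟩, ⟨150322, 9050, -506092,
    -153182⟩, ⟨-5919, 273, 43233, 15352⟩, ⟨-6308, -1189, -6482, 16046⟩, ⟨18566, -294, 64956,
    -18345⟩, ⟨14294, 2139, -163559, -15086⟩, ⟨-137393, -9387, 563244, 140461⟩, ⟨22602, 773, -23056,
    -22794⟩]⟩]⟩

def box1 : Cert :=
  ⟨3929822577, 115899180, [⟨⟨(2049057412, -17622473, 81759), (-980592427, 4304322, 73356),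
    (-12491808054, -120262872, -938310), (-11140547504, 11112219, -85424)⟩, [⟨7303, 467, 20516,
    -13365⟩, ⟨-9162, 1300, -955, 333⟩, ⟨3927, 1328, 160, -3106⟩, ⟨-1761, -643, 713, 1347⟩, ⟨-1120,
    -166, -3560, 1091⟩, ⟨12540, 8660, -72736, -5637⟩, ⟨-21334, 1776, -149778, 25575⟩, ⟨-110120,
    -16094, -354565, 107548⟩, ⟨60812, 21015, -5132, -47650⟩, ⟨-13116, -3369, -18176, 11404⟩, ⟨5259,
    1258, 8832, -4663⟩, ⟨-14347, -3790, -18144, 12373⟩, ⟨-520, -420, 4030, 174⟩, ⟨105659, 26828,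
    151552, -92167⟩, ⟨-3674, -1233, -305, 2915⟩, ⟨-5307, -1413, -6518, 4565⟩, ⟨12811, 3106, 20803,
    -11317⟩, ⟨10778, 3501, 2794, -8662⟩, ⟨-88016, -26974, -49603, 72298⟩, ⟨11642, 3114, 14083,
    -10002⟩]⟩, ⟨⟨(830294959, -20678306, 149876), (552896406, -1851587, -31060), (-33201209539,
    -191040885, -1409241), (804671529, -20497961, 153881)⟩, [⟨7868, -403, -471, 7644⟩, ⟨-11196,
    188, -20953, -10842⟩, ⟨4020, 257, -21576, 11413⟩, ⟨-4205, 1758, 6978, -12846⟩, ⟨8145, 141,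
    30849, 7863⟩, ⟨18436, -3407, -139468, 18134⟩, ⟨-16976, -608, -81907, -16359⟩, ⟨-109642, 6661,
    65626, -106612⟩, ⟨71119, -8383, -270718, 69521⟩, ⟨-15000, 1251, 28084, -14616⟩, ⟨4297, -720,
    -28367, 4220⟩, ⟨-18340, 1123, 11482, -17834⟩, ⟨-5878, -622, -51498, -5627⟩, ⟨115124, -10808,
    -283105, 112288⟩, ⟨-3615, 593, 23150, -3548⟩, ⟨-7139, 366, 487, -6935⟩, ⟨18833, -475, 26306,
    18252⟩, ⟨11202, -1587, -57619, 10975⟩, ⟨-99933, 10797, 325271, -97600⟩, ⟨15592, -821, -2236,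
    15150⟩]⟩, ⟨⟨(-6798392709, 77517448, -1160926), (4753134621, -78764776, 1026885), (-15217723699,
    -58143124, -2723269), (881787479, -47234597, 1144952)⟩, [⟨-26525, 21407, -40112, 25668⟩,
    ⟨26902, -28777, 36360, -30150⟩, ⟨-34891, 22276, -56359, 30337⟩, ⟨20486, -15806, 31423, -19401⟩,
    ⟨-11747, 19720, -11502, 17334⟩, ⟨98, -3079, -297646, 124966⟩, ⟨19516, -15963, 81651, -118249⟩,
    ⟨399252, -302906, 615553, -375108⟩, ⟨-587270, 401411, -932424, 526035⟩, ⟨52068, -35797, 82544,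
    -46760⟩, ⟨-11915, 4084, -21400, 8306⟩, ⟨67035, -50706, 103446, -62893⟩, ⟨29630, -33004, 39248,
    -33971⟩, ⟨-389647, 254223, -626057, 341963⟩, ⟨29422, -14992, 49843, -23371⟩, ⟨26224, -20677,
    39953, -25093⟩, ⟨-49734, 49102, -69727, 53352⟩, ⟨-81225, 43673, -136207, 65853⟩, ⟨591567,
    -352340, 971048, -499579⟩, ⟨-58104, 45395, -88780, 55355⟩]⟩, ⟨⟨(2008884860, -10338380, 163934),
    (-2667906201, 4911821, 142193), (-21737653624, -174190899, -1225555), (-4998112326, 39412219,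
    -453012)⟩, [⟨7634, 2044, 14075, -19300⟩, ⟨-3587, 13, -11345, 8608⟩, ⟨4715, 4119, -5197,
    -13266⟩, ⟨-1825, -1636, 2217, 5153⟩, ⟨-2642, -2118, 1987, 7343⟩, ⟨14646, 27570, -87995,
    -48169⟩, ⟨-24270, 9722, -123624, 53710⟩, ⟨-126264, -36467, -219863, 320443⟩, ⟨70203, 61737,
    -79377, -197705⟩, ⟨-14706, -11463, -3885, 25127⟩, ⟨10041, -1895, -10019, -1716⟩, ⟨-21290,
    -6168, -36979, 54040⟩, ⟨871, 542, 106, -2347⟩, ⟨121595, 74044, 22441, -326937⟩, ⟨-4980, -4550,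
    6459, 14106⟩, ⟨-4631, -2053, -4585, 12089⟩, ⟨9042, 1186, 22674, -22275⟩, ⟨13809, 11936, -14601,
    -38792⟩, ⟨-101473, -77548, 57895, 280260⟩, ⟨10249, 4663, 9566, -26815⟩]⟩, ⟨⟨(586108886,
    -14743150, 182033), (-451088134, 1930886, 21787), (-40360383251, -209261275, -1883210),
    (8092030296, 16268021, -173812)⟩, [⟨7580, 232, -3876, -7628⟩, ⟨-7046, 233, -36054, 6917⟩,
    ⟨4699, 455, -29967, -4850⟩, ⟨-2947, -105, 2796, 2972⟩, ⟨2427, -575, 56228, -2190⟩, ⟨22729,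
    2486, -170079, -23570⟩, ⟨-15608, 469, -75782, 15338⟩, ⟨-115847, -4768, 167555, 117057⟩, ⟨80916,
    6085, -360766, -82833⟩, ⟨-16352, -905, 44141, 16613⟩, ⟨5153, 522, -34849, -5327⟩, ⟨-19465,
    -811, 28997, 19672⟩, ⟨-4965, 453, -50996, 4761⟩, ⟨127059, 7816, -412599, -129392⟩, ⟨-4799, 202,
    33861, 12265⟩, ⟨-5294, -990, -4499, 13084⟩, ⟨13399, -159, 43461, -13262⟩, ⟨10372, 1548,
    -114181, -10916⟩, ⟨-112305, -7828, 446019, 114725⟩, ⟨16375, 592, -16430, -16514⟩]⟩]⟩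

def box2 : Cert :=
  ⟨3706137165, 107786237, [⟨⟨(2083350686, -16649045, 54036), (-988617350, 3726509, 69708),
    (-12263283200, -108348938, -873679), (-11162298898, 10621188, -63856)⟩, [⟨5710, 421, 15718,
    -10348⟩, ⟨-7121, 919, -920, 432⟩, ⟨2971, 1034, 88, -2354⟩, ⟨-1392, -521, 547, 1069⟩, ⟨-750,
    -104, -2561, 742⟩, ⟨10316, 7110, -56494, -4881⟩, ⟨-17805, 1341, -122262, 21172⟩, ⟨-89528,
    -13828, -282666, 87194⟩, ⟨48755, 17348, -4567, -38290⟩, ⟨-10479, -2780, -14336, 9118⟩, ⟨4279,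
    1057, 7118, -3797⟩, ⟨-11237, -3066, -14005, 9699⟩, ⟨-411, -316, 2789, 163⟩, ⟨86179, 22603,
    122066, -75230⟩, ⟨-2846, -983, -206, 2262⟩, ⟨-4233, -1166, -5100, 3643⟩, ⟨8660, 2174, 13841,
    -7651⟩, ⟨7303, 2446, 1787, -5879⟩, ⟨-69383, -21926, -38094, 57078⟩, ⟨7985, 2205, 9523,
    -6867⟩]⟩, ⟨⟨(870738376, -19733312, 111661), (556350629, -1605238, -29358), (-32837868750,
    -172435822, -1303846), (844782062, -19580344, 115300)⟩, [⟨6212, -335, -256, 6042⟩, ⟨-8751, 179,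
    -15809, -8485⟩, ⟨3084, 178, -15955, 8632⟩, ⟨-3261, 1353, 5318, -9733⟩, ⟨6016, 83, 22257, 5815⟩,
    ⟨15130, -2790, -109820, 14897⟩, ⟨-14419, -451, -67282, -13914⟩, ⟨-90177, 5691, 49790, -87789⟩,
    ⟨57542, -6896, -212339, 56316⟩, ⟨-12081, 1033, 21659, -11786⟩, ⟨3546, -596, -22532, 3486⟩,
    ⟨-14459, 920, 8403, -14077⟩, ⟨-4152, -420, -35434, -3980⟩, ⟨94787, -9072, -223250, 92559⟩,
    ⟨-2841, 467, 17505, -2792⟩, ⟨-5712, 311, 429, -5556⟩, ⟨12743, -364, 17317, 12365⟩, ⟨7680,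
    -1099, -38196, 7533⟩, ⟨-79516, 8746, 250070, -77750⟩, ⟨10745, -595, -1331, 10453⟩]⟩,
    ⟨⟨(-6952365468, 76313572, -1027898), (4908992772, -76959602, 896126), (-15115834730, -44034411,
    -2479539), (977296281, -48153836, 1044033)⟩, [⟨-21940, 17681, -32968, 21198⟩, ⟨22434, -23521,
    30248, -24736⟩, ⟨-27400, 17637, -43999, 23974⟩, ⟨16638, -12820, 25374, -15745⟩, ⟨-9454, 15193,
    -9388, 13395⟩, ⟨-1441, -1518, -242632, 104095⟩, ⟨18270, -14877, 72185, -100555⟩, ⟨342666,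
    -260637, 524753, -322353⟩, ⟨-488405, 335916, -770564, 439444⟩, ⟨43768, -30268, 68948, -39473⟩,
    ⟨-10277, 3711, -18349, 7358⟩, ⟨55164, -41827, 84561, -51820⟩, ⟨21851, -24114, 28696, -24771⟩,
    ⟨-334914, 220417, -534717, 295754⟩, ⟨23648, -12251, 39862, -19020⟩, ⟨22002, -17300, 33335,
    -21016⟩, ⟨-35657, 34739, -49759, 37829⟩, ⟨-57226, 31197, -95477, 46898⟩, ⟨485644, -292322,
    792731, -413506⟩, ⟨-41775, 32655, -63414, 39794⟩]⟩, ⟨⟨(2029435831, -10184106, 131948),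
    (-2676843958, 4039836, 131301), (-21406161207, -157407230, -1153394), (-5075822296, 38215281,
    -358779)⟩, [⟨6007, 1706, 10933, -15289⟩, ⟨-2962, -153, -8712, 7217⟩, ⟨3584, 3161, -3812,
    -10124⟩, ⟨-1464, -1323, 1713, 4150⟩, ⟨-1838, -1480, 1278, 5126⟩, ⟨12184, 22289, -68649,
    -39815⟩, ⟨-20216, 7662, -101455, 45187⟩, ⟨-102882, -31187, -177782, 262772⟩, ⟨56613, 50254,
    -61807, -160068⟩, ⟨-11826, -9246, -3465, 20641⟩, ⟨8112, -1413, -7655, -1830⟩, ⟨-16639, -5059,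
    -28680, 42506⟩, ⟨534, 316, 179, -1436⟩, ⟨99588, 61513, 20989, -269005⟩, ⟨-3863, -3556, 4832,
    10981⟩, ⟨-3750, -1732, -3606, 9856⟩, ⟨6254, 1017, 15046, -15561⟩, ⟨9388, 8192, -9566, -26479⟩,
    ⟨-80401, -62157, 43330, 223021⟩, ⟨7114, 3340, 6583, -18724⟩]⟩, ⟨⟨(615228375, -14345228,
    147330), (-454730102, 1712475, 21265), (-39963645966, -187675196, -1715056), (8060000241,
    15731212, -138936)⟩, [⟨6015, 196, -3120, -6054⟩, ⟨-5602, 156, -26564, 5512⟩, ⟨3607, 353,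
    -22306, -3718⟩, ⟨-2325, -90, 2473, 2346⟩, ⟨1829, -412, 40069, -1665⟩, ⟨18681, 2046, -134450,
    -19338⟩, ⟨-13301, 356, -61743, 13093⟩, ⟨-95505, -4084, 133509, 96488⟩, ⟨65669, 5027, -284592,
    -67173⟩, ⟨-13205, -750, 34528, 13409⟩, ⟨4259, 433, -27781, -4397⟩, ⟨-15388, -666, 22211,
    15550⟩, ⟨-3521, 308, -34914, 3387⟩, ⟨104862, 6584, -329075, -106725⟩, ⟨-3761, 144, 25697,
    9483⟩, ⟨-4291, -796, -3012, 10327⟩, ⟨9171, -75, 27762, -9091⟩, ⟨7170, 1068, -76150, -7528⟩,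
    ⟨-89612, -6366, 345394, 91480⟩, ⟨11319, 430, -11145, -11416⟩]⟩]⟩

def box3 : Cert :=
  ⟨3485579582, 112771351, [⟨⟨(2117618235, -17608614, 37060), (-995942857, 3588271, 82356),
    (-12045323239, -109478911, -1029035), (-11184283051, 11359481, -55862)⟩, [⟨7054, 591, 19046,
    -12667⟩, ⟨-8985, 1045, -1375, 753⟩, ⟨3700, 1326, 73, -2939⟩, ⟨-1787, -686, 682, 1378⟩, ⟨-976,
    -122, -3604, 981⟩, ⟨12992, 8944, -67284, -6431⟩, ⟨-23065, 1551, -155075, 27214⟩, ⟨-113866,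
    -18548, -352857, 110602⟩, ⟨61230, 22415, -6216, -48200⟩, ⟨-13170, -3606, -17803, 11468⟩, ⟨5537,
    1412, 9129, -4916⟩, ⟨-16136, -4544, -19836, 13938⟩, ⟨-645, -479, 3895, 288⟩, ⟨111166, 30099,
    155621, -97112⟩, ⟨-3711, -1320, -232, 2956⟩, ⟨-5508, -1567, -6518, 4743⟩, ⟨13552, 3519, 21339,
    -11975⟩, ⟨10933, 3771, 2530, -8816⟩, ⟨-89297, -29077, -47848, 73568⟩, ⟨11930, 3399, 14041,
    -10269⟩]⟩, ⟨⟨(911555054, -21076856, 97069), (559509216, -1548909, -34573), (-32490607890,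
    -174632328, -1529198), (885301164, -20932693, 101197)⟩, [⟨7748, -439, -159, 7545⟩, ⟨-11107,
    268, -19439, -10783⟩, ⟨3894, 201, -19430, 10752⟩, ⟨-4112, 1693, 6579, -11995⟩, ⟨8688, 89,
    31464, 8407⟩, ⟨19020, -3501, -132549, 18744⟩, ⟨-19002, -508, -85938, -18359⟩, ⟨-116008, 7600,
    58718, -113065⟩, ⟨72920, -8886, -260890, 71447⟩, ⟨-15308, 1342, 26257, -14950⟩, ⟨4652, -784,
    -28477, 4578⟩, ⟨-20898, 1381, 11211, -20369⟩, ⟨-5919, -571, -49269, -5681⟩, ⟨123414, -12045,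
    -278342, 120647⟩, ⟨-3757, 620, 22293, -3696⟩, ⟨-7458, 430, 580, -7263⟩, ⟨19965, -636, 26504,
    19397⟩, ⟨11631, -1681, -55955, 11421⟩, ⟨-103285, 11566, 313878, -101105⟩, ⟨16130, -937, -1655,
    15710⟩]⟩, ⟨⟨(-7112840401, 84262504, -1130472), (5070216157, -84340940, 969336), (-15036264546,
    -35223302, -2828067), (1080262653, -54940408, 1185209)⟩, [⟨-28706, 23100, -42869, 27702⟩,
    ⟨30370, -31256, 40851, -33008⟩, ⟨-35485, 23019, -56652, 31241⟩, ⟨21984, -16920, 33341, -20798⟩,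
    ⟨-14842, 22912, -14920, 20276⟩, ⟨-3811, -569, -303711, 133092⟩, ⟨26440, -21446, 99061,
    -133002⟩, ⟨460693, -351202, 700907, -433996⟩, ⟨-637275, 440889, -999244, 575963⟩, ⟨57961,
    -40307, 90745, -52497⟩, ⟨-14113, 5345, -25049, 10357⟩, ⟨83339, -63328, 126930, -78399⟩, ⟨32566,
    -35606, 42426, -36529⟩, ⟨-455908, 302510, -723387, 405043⟩, ⟨32051, -16873, 53757, -26090⟩,
    ⟨30152, -23648, 45437, -28764⟩, ⟨-59216, 56981, -82271, 62209⟩, ⟨-89212, 49290, -148096,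
    73884⟩, ⟨651958, -396442, 1058344, -559600⟩, ⟨-65519, 51235, -98830, 62421⟩]⟩, ⟨⟨(2050809828,
    -11192165, 129374), (-2684550779, 3649576, 151016), (-21089033923, -159535673, -1373169),
    (-5155463876, 41426509, -342977)⟩, [⟨7467, 2243, 13434, -19131⟩, ⟨-3950, -397, -10887, 9753⟩,
    ⟨4485, 3994, -4601, -12719⟩, ⟨-1904, -1736, 2146, 5417⟩, ⟨-2495, -2020, 1594, 6982⟩, ⟨15498,
    27631, -82101, -50368⟩, ⟨-26152, 9344, -129393, 59019⟩, ⟨-131157, -41666, -225132, 337076⟩,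
    ⟨71500, 64090, -75342, -202958⟩, ⟨-14957, -11742, -4798, 26626⟩, ⟨10425, -1662, -9294, -2911⟩,
    ⟨-23845, -7597, -40826, 61292⟩, ⟨649, 358, 387, -1737⟩, ⟨128984, 80854, 30497, -349998⟩,
    ⟨-5043, -4682, 6086, 14391⟩, ⟨-4949, -2378, -4639, 13094⟩, ⟨9998, 1923, 23161, -25113⟩, ⟨14099,
    12426, -13839, -39924⟩, ⟨-103992, -81362, 52837, 289689⟩, ⟨10751, 5206, 9881, -28461⟩]⟩,
    ⟨⟨(645180177, -15609429, 144910), (-458141940, 1695620, 25817), (-39586920441, -188821089,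
    -1975756), (8027249363, 17020726, -134251)⟩, [⟨7541, 262, -3930, -7592⟩, ⟨-7230, 166, -31852,
    7129⟩, ⟨4558, 450, -27342, -4693⟩, ⟨-2981, -126, 3458, 3009⟩, ⟨2695, -578, 55905, -2473⟩,
    ⟨23519, 2580, -162908, -24308⟩, ⟨-17591, 413, -78228, 17342⟩, ⟨-123172, -5468, 166220, 124422⟩,
    ⟨83481, 6504, -351666, -85331⟩, ⟨-16776, -977, 42477, 17030⟩, ⟨5597, 573, -35240, -5770⟩,
    ⟨-22304, -1002, 31151, 22535⟩, ⟨-5043, 421, -48312, 4863⟩, ⟨136874, 8773, -415071, -139229⟩,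
    ⟨-4963, 171, 32843, 12350⟩, ⟨-5672, -1045, -3246, 13307⟩, ⟨14533, -67, 41171, -14425⟩, ⟨10948,
    1627, -112243, -11468⟩, ⟨-116739, -8451, 436690, 119094⟩, ⟨17045, 680, -16419, -17190⟩]⟩]⟩

def box4 : Cert :=
  ⟨3267930881, 104877356, [⟨⟨(2151709854, -16463502, 9467), (-1002554928, 3032188, 75526),
    (-11837956352, -97984088, -956994), (-11206394540, 10734843, -33338)⟩, [⟨5118, 480, 13568,
    -9111⟩, ⟨-6349, 658, -1115, 673⟩, ⟨2535, 934, 28, -2018⟩, ⟨-1266, -498, 470, 980⟩, ⟨-589, -63,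
    -2371, 603⟩, ⟨9941, 6842, -48781, -5122⟩, ⟨-17958, 1060, -118347, 21031⟩, ⟨-85900, -14726,
    -261524, 83225⟩, ⟨45611, 17164, -4924, -35988⟩, ⟨-9783, -2763, -13080, 8526⟩, ⟨4234, 1114,
    6925, -3762⟩, ⟨-11844, -3440, -14377, 10238⟩, ⟨-485, -350, 2633, 236⟩, ⟨84059, 23478, 116406,
    -73483⟩, ⟨-2632, -963, -143, 2101⟩, ⟨-4028, -1183, -4687, 3471⟩, ⟨8018, 2152, 12453, -7087⟩,
    ⟨6726, 2388, 1477, -5432⟩, ⟨-64857, -21743, -33982, 53512⟩, ⟨7193, 2113, 8363, -6197⟩]⟩,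
    ⟨⟨(952558377, -19896089, 57072), (562367172, -1312597, -31660), (-32159398899, -156721205,
    -1419420), (926041764, -19777020, 60722)⟩, [⟨5675, -337, 11, 5532⟩, ⟨-7896, 219, -13439,
    -7675⟩, ⟨2704, 123, -13019, 7369⟩, ⟨-2866, 1172, 4491, -8175⟩, ⟨5859, 39, 20818, 5676⟩, ⟨14536,
    -2674, -97341, 14338⟩, ⟨-15043, -336, -66089, -14552⟩, ⟨-88502, 6012, 40766, -86350⟩, ⟨54803,
    -6790, -190129, 53754⟩, ⟨-11463, 1030, 18801, -11208⟩, ⟨3607, -610, -21286, 3553⟩, ⟨-15440,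
    1058, 7596, -15065⟩, ⟨-4085, -375, -33202, -3925⟩, ⟨94184, -9374, -203370, 92169⟩, ⟨-2702, 448,
    15451, -2661⟩, ⟨-5474, 333, 419, -5337⟩, ⟨11831, -416, 15406, 11508⟩, ⟨7237, -1056, -33694,
    7113⟩, ⟨-75701, 8630, 222332, -74183⟩, ⟨9772, -595, -778, 9528⟩]⟩, ⟨⟨(-7279659712, 82391291,
    -958164), (5236566878, -81857481, 805416), (-14978930859, -22447296, -2517021), (1190744072,
    -55391033, 1041272)⟩, [⟨-22077, 17741, -32776, 21288⟩, ⟨23019, -23290, 30892, -24705⟩, ⟨-25316,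
    16545, -40187, 22424⟩, ⟨16066, -12353, 24234, -15200⟩, ⟨-10858, 16153, -11032, 14357⟩, ⟨-4511,
    646, -231706, 103666⟩, ⟨22913, -18521, 81704, -105948⟩, ⟨367795, -280944, 556051, -347014⟩,
    ⟨-493938, 343622, -769831, 448405⟩, ⟨45427, -31756, 70695, -41319⟩, ⟨-11468, 4536, -20231,
    8609⟩, ⟨64443, -49063, 97539, -60717⟩, ⟨23520, -25477, 30413, -26122⟩, ⟨-364249, 243557,
    -574446, 325520⟩, ⟨23665, -12652, 39494, -19489⟩, ⟨23247, -18191, 34850, -22160⟩, ⟨-37205,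
    35389, -51475, 38751⟩, ⟨-57236, 32035, -94537, 47886⟩, ⟨494660, -303745, 798616, -427928⟩,
    ⟨-41528, 32483, -62262, 39580⟩]⟩, ⟨⟨(2072869695, -10839261, 94839), (-2691025025, 2842364,
    134883), (-20786389947, -143227680, -1290871), (-5236619401, 39646772, -240768)⟩, [⟨5450, 1727,
    9706, -14053⟩, ⟨-2935, -423, -7634, 7333⟩, ⟨3087, 2777, -3053, -8787⟩, ⟨-1365, -1255, 1481,
    3898⟩, ⟨-1579, -1286, 920, 4434⟩, ⟨11966, 20846, -59753, -38711⟩, ⟨-20342, 6827, -99303,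
    46334⟩, ⟨-99185, -32967, -169283, 256446⟩, ⟨53551, 48484, -54441, -152598⟩, ⟨-11178, -8821,
    -3885, 20265⟩, ⟨7923, -1145, -6663, -2626⟩, ⟨-17471, -5823, -29745, 45180⟩, ⟨372, 184, 348,
    -990⟩, ⟨97920, 62320, 25618, -266894⟩, ⟨-3582, -3354, 4168, 10258⟩, ⟨-3669, -1829, -3364,
    9767⟩, ⟨6036, 1331, 13508, -15295⟩, ⟨8700, 7747, -8224, -24732⟩, ⟨-75895, -60112, 36275,
    212304⟩, ⟨6554, 3271, 5994, -17449⟩]⟩, ⟨⟨(675820492, -14998915, 106061), (-461315345, 1479976,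
    24358), (-39229981210, -168327992, -1797958), (7993926825, 16270434, -95519)⟩, [⟨5552, 204,
    -2882, -5590⟩, ⟨-5223, 96, -21446, 5160⟩, ⟨3167, 316, -18439, -3258⟩, ⟨-2112, -96, 2618, 2132⟩,
    ⟨1854, -377, 36482, -1713⟩, ⟨18002, 1979, -120097, -18578⟩, ⟨-13978, 283, -59688, 13799⟩,
    ⟨-94218, -4338, 122584, 95160⟩, ⟨62940, 4991, -257741, -64290⟩, ⟨-12598, -752, 30877, 12784⟩,
    ⟨4346, 447, -26436, -4475⟩, ⟨-16527, -771, 22305, 16696⟩, ⟨-3496, 279, -32403, 3379⟩, ⟨104728,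
    6853, -306885, -106474⟩, ⟨-3562, 109, 22844, 8752⟩, ⟨-4214, -771, -1936, 9646⟩, ⟨8709, -9,
    23162, -8654⟩, ⟨6867, 1019, -68013, -7178⟩, ⟨-85817, -6330, 311584, 87494⟩, ⟨10360, 432, -9734,
    -10448⟩]⟩]⟩

def box5 : Cert :=
  ⟨3053325596, 109727934, [⟨⟨(2185402857, -17210978, -18208), (-1008438523, 2841925, 86084),
    (-11641560862, -98267953, -1125300), (-11228476429, 11336885, -16892)⟩, [⟨5998, 622, 15634,
    -10593⟩, ⟨-8069, 735, -1591, 1025⟩, ⟨2866, 1085, 12, -2285⟩, ⟨-1454, -586, 524, 1130⟩, ⟨-688,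
    -58, -3048, 721⟩, ⟨11860, 8165, -55254, -6332⟩, ⟨-21876, 1110, -141484, 25439⟩, ⟨-100496,
    -18090, -300919, 97131⟩, ⟨52800, 20405, -5967, -41758⟩, ⟨-11440, -3329, -15142, 9976⟩, ⟨5135,
    1392, 8337, -4565⟩, ⟨-15413, -4612, -18495, 13333⟩, ⟨-705, -498, 3475, 365⟩, ⟨99422, 28618,
    136324, -86971⟩, ⟨-3131, -1177, -148, 2504⟩, ⟨-4781, -1448, -5477, 4121⟩, ⟨10967, 3038, 16819,
    -9694⟩, ⟨9256, 3379, 1937, -7489⟩, ⟨-76081, -26235, -39064, 62864⟩, ⟨9490, 2871, 10912,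
    -8183⟩]⟩, ⟨⟨(993466795, -20993775, 27212), (564918518, -1234773, -36088), (-31844795718,
    -157668642, -1669952), (966721873, -20884899, 31233)⟩, [⟨6713, -417, 174, 6552⟩, ⟨-10095, 315,
    -16772, -9823⟩, ⟨3096, 123, -14398, 8334⟩, ⟨-3243, 1317, 4972, -9056⟩, ⟨7712, 25, 26946, 7479⟩,
    ⟨17330, -3187, -111621, 17108⟩, ⟨-18621, -336, -79666, -18035⟩, ⟨-104679, 7367, 43515,
    -102241⟩, ⟨63992, -8059, -215346, 62831⟩, ⟨-13511, 1244, 21176, -13223⟩, ⟨4432, -753, -25248,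
    4370⟩, ⟨-20222, 1435, 9059, -19752⟩, ⟨-5503, -480, -43738, -5294⟩, ⟨112407, -11408, -232375,
    110112⟩, ⟨-3257, 542, 17965, -3210⟩, ⟨-6521, 417, 467, -6365⟩, ⟨16211, -622, 20788, 15786⟩,
    ⟨10070, -1485, -45406, 9908⟩, ⟨-89595, 10396, 254378, -87887⟩, ⟨12955, -824, -716, 12645⟩]⟩,
    ⟨⟨(-7452206271, 90208454, -993193), (5407365160, -88971247, 813877), (-14943598862, -12620826,
    -2792234), (1308442785, -62397974, 1127167)⟩, [⟨-27446, 22026, -40517, 26454⟩, ⟨31360, -31236,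
    41992, -33289⟩, ⟨-29836, 19637, -47098, 26585⟩, ⟨19078, -14657, 28627, -18059⟩, ⟨-15472, 22248,
    -15869, 19873⟩, ⟨-7368, 2128, -276428, 126193⟩, ⟨30953, -24944, 105420, -132304⟩, ⟨455738,
    -348733, 684832, -430691⟩, ⟨-595696, 416576, -922979, 543153⟩, ⟨56096, -39407, 86790, -51238⟩,
    ⟨-14787, 6085, -25928, 11335⟩, ⟨88431, -67443, 133044, -83458⟩, ⟨33189, -35624, 42621, -36525⟩,
    ⟨-455610, 306849, -714269, 409488⟩, ⟨29339, -15919, 48718, -24431⟩, ⟨29111, -22733, 43421,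
    -27741⟩, ⟨-54052, 50864, -74486, 55876⟩, ⟨-82251, 46611, -135174, 69493⟩, ⟨606920, -376178,
    974578, -529045⟩, ⟨-57656, 45107, -85938, 54986⟩]⟩, ⟨⟨(2095418534, -11702734, 80520),
    (-2696273032, 2391529, 149589), (-20498866794, -144090840, -1534288), (-5318663002, 42368022,
    -187580)⟩, [⟨6426, 2140, 11342, -16669⟩, ⟨-3903, -716, -9646, 9858⟩, ⟨3504, 3185, -3341,
    -10014⟩, ⟨-1585, -1471, 1656, 4544⟩, ⟨-1949, -1595, 1026, 5489⟩, ⟨14391, 24560, -67918,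
    -46378⟩, ⟨-24768, 7780, -119393, 56916⟩, ⟨-116329, -40381, -197615, 302523⟩, ⟨62316, 56997,
    -61098, -178243⟩, ⟨-13145, -10436, -4909, 24235⟩, ⟨9552, -1237, -7568, -3649⟩, ⟨-22700, -7900,
    -38468, 59043⟩, ⟨404, 165, 566, -1061⟩, ⟨116262, 75143, 33283, -318271⟩, ⟨-4265, -4030, 4787,
    12259⟩, ⟨-4411, -2277, -3970, 11812⟩, ⟨8412, 2081, 18250, -21493⟩, ⟨12009, 10805, -10930,
    -34268⟩, ⟨-89444, -71733, 40126, 251226⟩, ⟨8738, 4490, 7968, -23390⟩]⟩, ⟨⟨(706923602,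
    -16095806, 88951), (-464239176, 1440217, 28616), (-38893196995, -168216288, -2070705),
    (7960267891, 17378098, -75920)⟩, [⟨6602, 256, -3387, -6647⟩, ⟨-6783, 94, -26043, 6711⟩, ⟨3631,
    366, -20522, -3731⟩, ⟨-2427, -117, 3166, 2452⟩, ⟨2489, -481, 46549, -2315⟩, ⟨21496, 2370,
    -138233, -22153⟩, ⟨-17371, 297, -71407, 17170⟩, ⟨-111750, -5331, 140004, 112852⟩, ⟨73731, 5948,
    -293561, -75262⟩, ⟨-14892, -912, 35321, 15105⟩, ⟨5351, 554, -31466, -5503⟩, ⟨-21712, -1049,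
    28277, 21931⟩, ⟨-4732, 359, -42494, 4585⟩, ⟨125327, 8369, -354901, -127353⟩, ⟨-4286, 116,
    26657, 10405⟩, ⟨-5080, -924, -1841, 11356⟩, ⟨12063, 28, 30231, -12000⟩, ⟨9632, 1428, -92238,
    -10048⟩, ⟨-101877, -7656, 359084, 103807⟩, ⟨13780, 601, -12589, -13897⟩]⟩]⟩

def box6 : Cert :=
  ⟨2841550688, 102046979, [⟨⟨(2218513316, -15883983, -43747), (-1013599951, 2330107, 76082),
    (-11456195575, -87203910, -1044230), (-11250392275, 10564005, 5140)⟩, [⟨4431, 503, 11367,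
    -7767⟩, ⟨-6138, 483, -1336, 901⟩, ⟨1773, 689, -3, -1417⟩, ⟨-980, -404, 343, 764⟩, ⟨-383, -21,
    -1882, 411⟩, ⟨9192, 6335, -40747, -5065⟩, ⟨-16689, 709, -106050, 19276⟩, ⟨-67693, -12764,
    -199574, 65277⟩, ⟨35050, 13895, -4092, -27783⟩, ⟨-7693, -2305, -10091, 6714⟩, ⟨3656, 1021,
    5898, -3253⟩, ⟨-10674, -3287, -12676, 9241⟩, ⟨-520, -362, 2352, 284⟩, ⟨66570, 19728, 90468,
    -58270⟩, ⟨-1963, -757, -81, 1573⟩, ⟨-3064, -956, -3461, 2643⟩, ⟨5513, 1575, 8360, -4875⟩,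
    ⟨5477, 2053, 1097, -4439⟩, ⟨-49028, -17371, -24725, 40569⟩, ⟨4809, 1497, 5475, -4150⟩]⟩,
    ⟨⟨(1034036994, -19549883, -12095), (567165969, -1017096, -31938), (-31546869548, -140412638,
    -1554338), (1007096893, -19463015, -8651)⟩, [⟨5004, -324, 257, 4889⟩, ⟨-7726, 268, -12577,
    -7526⟩, ⟨1939, 66, -8719, 5160⟩, ⟨-2157, 870, 3230, -5899⟩, ⟨4871, 0, 16773, 4729⟩, ⟨13428,
    -2470, -83281, 13266⟩, ⟨-14426, -200, -60242, -13987⟩, ⟨-71263, 5188, 26474, -69671⟩, ⟨42838,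
    -5482, -139883, 42101⟩, ⟨-9156, 863, 13709, -8970⟩, ⟨3196, -546, -17597, 3154⟩, ⟨-14093, 1035,
    5701, -13779⟩, ⟨-3800, -314, -29582, -3660⟩, ⟨75930, -7856, -150295, 74451⟩, ⟨-2068, 346,
    11015, -2040⟩, ⟨-4195, 281, 267, -4099⟩, ⟨8167, -339, 10353, 7961⟩, ⟨6023, -898, -26319, 5931⟩,
    ⟨-58238, 6876, 159907, -57183⟩, ⟨6597, -437, -196, 6446⟩]⟩, ⟨⟨(-7629900838, 87297018, -773846),
    (5581992415, -85486645, 611677), (-14929640408, -1723888, -2401683), (1433018746, -61996606,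
    929998)⟩, [⟨-21514, 17242, -31588, 20733⟩, ⟨25559, -25095, 34150, -26874⟩, ⟨-19267, 12766,
    -30248, 17266⟩, ⟨13316, -10223, 19880, -12615⟩, ⟨-10556, 14714, -10918, 13214⟩, ⟨-7315, 2753,
    -214844, 100011⟩, ⟨26091, -20969, 85149, -103645⟩, ⟨325298, -249307, 485973, -307947⟩,
    ⟨-412393, 289801, -635319, 377628⟩, ⟨39865, -28133, 61328, -36562⟩, ⟨-11200, 4779, -19518,
    8752⟩, ⟨64623, -49361, 96664, -61095⟩, ⟨24026, -25558, 30659, -26219⟩, ⟨-322817, 218883,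
    -503160, 291728⟩, ⟨19190, -10561, 31706, -16150⟩, ⟨19695, -15352, 29235, -18770⟩, ⟨-28867,
    26895, -39631, 29648⟩, ⟨-50871, 29174, -83186, 43385⟩, ⟨409487, -256077, 654050, -359559⟩,
    ⟨-30775, 24079, -45614, 29374⟩]⟩, ⟨⟨(2118271523, -11123817, 45404), (-2700331969, 1688339,
    128305), (-20226644273, -128267210, -1439001), (-5401023867, 39916863, -83360)⟩, [⟨4774, 1667,
    8364, -12457⟩, ⟨-3095, -678, -7311, 7892⟩, ⟨2177, 2000, -2000, -6245⟩, ⟨-1079, -1011, 1085,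
    3105⟩, ⟨-1153, -949, 542, 3257⟩, ⟨11234, 18827, -50243, -36090⟩, ⟨-18892, 5533, -90004, 43780⟩,
    ⟨-78556, -28424, -132955, 205433⟩, ⟨41572, 38416, -39299, -119345⟩, ⟨-8887, -7104, -3542,
    16641⟩, ⟨6765, -775, -5044, -2914⟩, ⟨-15698, -5694, -26507, 41059⟩, ⟨214, 59, 449, -552⟩,
    ⟨78138, 51292, 24252, -214806⟩, ⟨-2677, -2552, 2898, 7721⟩, ⟨-2861, -1527, -2536, 7706⟩, ⟨4304,
    1175, 9081, -11082⟩, ⟨7126, 6480, -6243, -20410⟩, ⟨-57898, -47020, 24320, 163263⟩, ⟨4473, 2364,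
    4074, -12036⟩]⟩, ⟨⟨(738280361, -15230317, 47943), (-466910100, 1233689, 26136), (-38576385002,
    -148815387, -1884739), (7926486722, 16373353, -35357)⟩, [⟨4946, 202, -2489, -4981⟩, ⟨-5269, 50,
    -18994, 5221⟩, ⟨2278, 232, -12505, -2338⟩, ⟨-1639, -84, 2221, 1656⟩, ⟨1603, -294, 28553,
    -1499⟩, ⟨16683, 1846, -103514, -17171⟩, ⟨-13512, 189, -53611, 13370⟩, ⟨-76296, -3766, 91929,
    77037⟩, ⟨49516, 4063, -191737, -50513⟩, ⟨-10122, -635, 23230, 10263⟩, ⟨3867, 403, -22006,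
    -3972⟩, ⟨-15179, -759, 19052, 15329⟩, ⟨-3284, 237, -28616, 3188⟩, ⟨84890, 5784, -232354,
    -86223⟩, ⟨-2718, 63, 16402, 6522⟩, ⟨-3306, -598, -925, 7226⟩, ⟨6142, 34, 14561, -6116⟩, ⟨5806,
    860, -53808, -6045⟩, ⟨-66426, -5084, 227349, 67646⟩, ⟨7041, 320, -6237, -7101⟩]⟩]⟩

def box7 : Cert :=
  ⟨2632737063, 106766651, [⟨⟨(2250790550, -16365982, -81899), (-1018048634, 2111258, 83434),
    (-11282229180, -86608301, -1224420), (-11271957053, 10983591, 30184)⟩, [⟨5107, 629, 12911,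
    -8891⟩, ⟨-7407, 494, -1756, 1225⟩, ⟨2191, 873, -13, -1755⟩, ⟨-1314, -554, 447, 1028⟩, ⟨-365,
    -6, -2018, 405⟩, ⟨10482, 7235, -44318, -5939⟩, ⟨-18790, 644, -117465, 21567⟩, ⟨-65531, -12911,
    -190447, 63058⟩, ⟨33498, 13607, -3995, -26613⟩, ⟨-7740, -2384, -10071, 6759⟩, ⟨3948, 1133,
    6333, -3514⟩, ⟨-12038, -3811, -14165, 10429⟩, ⟨-653, -449, 2728, 372⟩, ⟨64379, 19618, 86800,
    -56387⟩, ⟨-1909, -755, -70, 1533⟩, ⟨-2947, -945, -3286, 2543⟩, ⟨5579, 1641, 8373, -4934⟩,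
    ⟨6205, 2386, 1196, -5037⟩, ⟨-46542, -16924, -23108, 38566⟩, ⟨4934, 1578, 5568, -4261⟩]⟩,
    ⟨⟨(1073935517, -20317283, -57683), (569113064, -926866, -35113), (-31266221513, -139999186,
    -1832477), (1046831977, -20240965, -54016)⟩, [⟨5818, -392, 451, 5689⟩, ⟨-9379, 357, -15014,
    -9145⟩, ⟨2424, 70, -10549, 6382⟩, ⟨-2859, 1146, 4177, -7662⟩, ⟨5335, -18, 18144, 5185⟩, ⟨15314,
    -2820, -91582, 15142⟩, ⟨-16482, -163, -67346, -15998⟩, ⟨-69696, 5242, 22879, -68203⟩, ⟨41274,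
    -5366, -130855, 40600⟩, ⟨-9282, 895, 13271, -9101⟩, ⟨3495, -600, -18614, 3451⟩, ⟨-15991, 1213,
    5787, -15650⟩, ⟨-4497, -352, -34337, -4336⟩, ⟨74059, -7808, -140404, 72681⟩, ⟨-2036, 342,
    10486, -2010⟩, ⟨-4050, 283, 215, -3961⟩, ⟨8282, -370, 10416, 8081⟩, ⟨6894, -1038, -29221,
    6795⟩, ⟨-55750, 6696, 148115, -54788⟩, ⟨6800, -469, -23, 6651⟩]⟩, ⟨⟨(-7811608817, 94387982,
    -705002), (5759311786, -91792613, 524953), (-14936094066, 8353961, -2553303), (1563668446,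
    -68676861, 922920)⟩, [⟨-26307, 21057, -38425, 25355⟩, ⟨33007, -31985, 44009, -34422⟩, ⟨-24865,
    16579, -38829, 22406⟩, ⟨18517, -14209, 27511, -17560⟩, ⟨-12461, 16880, -12985, 15248⟩, ⟨-10243,
    4455, -246334, 116839⟩, ⟨32335, -25925, 101436, -120009⟩, ⟨333725, -256114, 495780, -316482⟩,
    ⟨-411327, 290372, -630174, 378214⟩, ⟨42394, -30046, 64861, -39037⟩, ⟨-12864, 5673, -22282,
    10230⟩, ⟨76925, -58838, 114429, -72858⟩, ⟨29814, -31440, 37825, -32287⟩, ⟨-330412, 225442,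
    -512106, 300151⟩, ⟨19489, -10870, 32040, -16566⟩, ⟨19995, -15561, 29541, -19063⟩, ⟨-31019,
    28636, -42433, 31681⟩, ⟨-60275, 34961, -98078, 51865⟩, ⟨407241, -256832, 647069, -360083⟩,
    ⟨-33266, 26030, -49042, 31782⟩]⟩, ⟨⟨(2141185848, -11773806, 18805), (-2703254153, 1224759,
    135915), (-19970365610, -127786892, -1705095), (-5482929540, 41928410, 9223)⟩, [⟨5532, 2019,
    9632, -14515⟩, ⟨-3877, -975, -8803, 9974⟩, ⟨2701, 2507, -2391, -7775⟩, ⟨-1461, -1382, 1414,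
    4217⟩, ⟨-1182, -977, 490, 3348⟩, ⟨12894, 21266, -54796, -41315⟩, ⟨-21273, 5790, -100260,
    49693⟩, ⟨-76241, -28695, -128684, 200439⟩, ⟨39920, 37269, -36379, -115002⟩, ⟨-8986, -7237,
    -3798, 17068⟩, ⟨7269, -726, -5096, -3471⟩, ⟨-17683, -6670, -29779, 46495⟩, ⟨181, 7, 590, -448⟩,
    ⟨75838, 50557, 25319, -209328⟩, ⟨-2607, -2508, 2722, 7543⟩, ⟨-2782, -1532, -2437, 7534⟩, ⟨4427,
    1314, 9112, -11479⟩, ⟨8095, 7439, -6826, -23267⟩, ⟨-55197, -45391, 21657, 156239⟩, ⟨4633, 2515,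
    4221, -12528⟩]⟩, ⟨⟨(769600022, -16068191, 14672), (-469323552, 1176529, 29720), (-38279899334,
    -147417947, -2171855), (7892882664, 17207371, 557)⟩, [⟨5780, 247, -2833, -5821⟩, ⟨-6487, 36,
    -22049, 6437⟩, ⟨2852, 293, -15223, -2925⟩, ⟨-2202, -119, 3071, 2225⟩, ⟨1789, -312, 30433,
    -1682⟩, ⟨19058, 2116, -114232, -19592⟩, ⟨-15500, 171, -59534, 15353⟩, ⟨-74837, -3817, 86630,
    75554⟩, ⟨47861, 3992, -180319, -48796⟩, ⟨-10291, -661, 22854, 10431⟩, ⟨4236, 445, -23354,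
    -4347⟩, ⟨-17277, -892, 20878, 17446⟩, ⟨-3905, 268, -33082, 3799⟩, ⟨83028, 5770, -219736,
    -84295⟩, ⟨-2673, 53, 15668, 6345⟩, ⟨-3226, -581, -679, 6904⟩, ⟨6292, 55, 14175, -6270⟩, ⟨6695,
    992, -60126, -6959⟩, ⟨-63782, -4969, 212070, 64921⟩, ⟨7282, 344, -6238, -7344⟩]⟩]⟩

def box8 : Cert :=
  ⟨2414265808, 111704609, [⟨⟨(2283882861, -16689267, -132741), (-1022021183, 1854681, 89415),
    (-11110257547, -85180546, -1438624), (-11294266505, 11301412, 64789)⟩, [⟨5552, 740, 13840,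
    -9603⟩, ⟨-8492, 462, -2178, 1561⟩, ⟨2531, 1034, -24, -2031⟩, ⟨-1665, -718, 548, 1307⟩, ⟨-306,
    12, -1935, 352⟩, ⟨10970, 7589, -44236, -6380⟩, ⟨-19220, 495, -118257, 21923⟩, ⟨-51171, -10532,
    -146659, 49137⟩, ⟨27079, 11271, -3268, -21564⟩, ⟨-7452, -2360, -9625, 6512⟩, ⟨4135, 1221, 6598,
    -3682⟩, ⟨-12480, -4063, -14561, 10820⟩, ⟨-750, -510, 2901, 443⟩, ⟨49206, 15423, 65859, -43124⟩,
    ⟨-1916, -777, -63, 1542⟩, ⟨-3238, -1069, -3568, 2796⟩, ⟨4387, 1329, 6522, -3881⟩, ⟨6217, 2453,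
    1157, -5056⟩, ⟨-34518, -12883, -16900, 28644⟩, ⟨4351, 1431, 4871, -3761⟩]⟩, ⟨⟨(1115196848,
    -20899375, -120807), (570863195, -820385, -37776), (-30987626378, -138310415, -2170743),
    (1087952264, -20834860, -116996)⟩, [⟨6383, -448, 677, 6247⟩, ⟨-10819, 448, -17078, -10560⟩,
    ⟨2834, 66, -11924, 7381⟩, ⟨-3583, 1428, 5096, -9412⟩, ⟨5227, -35, 17579, 5085⟩, ⟨16036, -2958,
    -92411, 15867⟩, ⟨-17110, -99, -68491, -16625⟩, ⟨-54992, 4274, 15600, -53863⟩, ⟨33640, -4444,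
    -103445, 33121⟩, ⟨-9005, 889, 12261, -8838⟩, ⟨3705, -639, -19088, 3662⟩, ⟨-16683, 1308, 5302,
    -16342⟩, ⟨-4880, -360, -36570, -4711⟩, ⟨57098, -6138, -103468, 56085⟩, ⟨-2068, 350, 10295,
    -2044⟩, ⟨-4469, 326, 176, -4375⟩, ⟨6529, -312, 8171, 6377⟩, ⟨6980, -1063, -28680, 6885⟩,
    ⟨-41699, 5096, 107067, -41016⟩, ⟨6026, -432, 152, 5899⟩]⟩, ⟨⟨(-8007429533, 101341338, -538435),
    (5949071483, -97862092, 346542), (-14963688026, 19363757, -2620481), (1707862298, -75485235,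
    834312)⟩, [⟨-30437, 24333, -44227, 29346⟩, ⟨40602, -38853, 54019, -42031⟩, ⟨-30087, 20188,
    -46727, 27264⟩, ⟨24417, -18727, 36097, -23183⟩, ⟨-13180, 17369, -13831, 15790⟩, ⟨-12906, 6183,
    -259976, 125669⟩, ⟨36462, -29168, 110046, -126630⟩, ⟨277033, -212875, 409239, -263216⟩,
    ⟨-348056, 246811, -530227, 321384⟩, ⟨43278, -30802, 65843, -40013⟩, ⟨-14373, 6542, -24737,
    11624⟩, ⟨84439, -64668, 124904, -80130⟩, ⟨34022, -35560, 42926, -36574⟩, ⟨-268124, 184072,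
    -413177, 244843⟩, ⟨20485, -11580, 33501, -17586⟩, ⟨23268, -18082, 34213, -22199⟩, ⟨-25978,
    23770, -35411, 26401⟩, ⟨-63362, 37172, -102568, 55006⟩, ⟨317392, -201863, 501583, -282599⟩,
    ⟨-31006, 24262, -45464, 29657⟩]⟩, ⟨⟨(2165306462, -12320868, -20186), (-2705201912, 716592,
    139244), (-19716220481, -126088829, -2025257), (-5568523444, 43574466, 142694)⟩, [⟨6047, 2305,
    10475, -15955⟩, ⟨-4607, -1302, -10088, 11952⟩, ⟨3132, 2939, -2666, -9048⟩, ⟨-1868, -1785, 1737,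
    5411⟩, ⟨-1079, -897, 384, 3065⟩, ⟨13577, 22067, -54831, -43409⟩, ⟨-21770, 5462, -101539,
    51258⟩, ⟨-59694, -23369, -100564, 157774⟩, ⟨32423, 30597, -28422, -93737⟩, ⟨-8695, -7061,
    -3889, 16742⟩, ⟨7576, -641, -4971, -3973⟩, ⟨-18312, -7183, -30783, 48405⟩, ⟨118, -61, 698,
    -263⟩, ⟨58176, 39414, 20827, -161235⟩, ⟨-2619, -2544, 2633, 7605⟩, ⟨-3092, -1755, -2683, 8417⟩,
    ⟨3537, 1135, 7116, -9237⟩, ⟨8133, 7558, -6586, -23461⟩, ⟨-41112, -34253, 14966, 116818⟩, ⟨4124,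
    2301, 3765, -11209⟩]⟩, ⟨⟨(802478496, -16777040, -34890), (-471605460, 1102063, 33265),
    (-37987507045, -144677545, -2511562), (7857739051, 17900411, 53243)⟩, [⟨6373, 285, -3017,
    -6418⟩, ⟨-7591, 12, -24358, 7540⟩, ⟨3340, 347, -17314, -3422⟩, ⟨-2799, -159, 3988, 2829⟩,
    ⟨1786, -296, 29027, -1688⟩, ⟨19991, 2230, -115675, -20528⟩, ⟨-16160, 129, -60156, 16021⟩,
    ⟨-59232, -3123, 65649, 59791⟩, ⟨39139, 3320, -143326, -39882⟩, ⟨-10016, -659, 21485, 10149⟩,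
    ⟨4501, 477, -24027, -4614⟩, ⟨-18085, -965, 20970, 18259⟩, ⟨-4260, 276, -35093, 4151⟩, ⟨64201,
    4552, -164045, -65153⟩, ⟨-2713, 44, 15437, 6371⟩, ⟨-3600, -646, -539, 7542⟩, ⟨5012, 59, 10749,
    -4999⟩, ⟨6831, 1012, -59412, -7089⟩, ⟨-47861, -3798, 154415, 48690⟩, ⟨6477, 318, -5339,
    -6531⟩]⟩]⟩

def box9 : Cert :=
  ⟨2172704597, 129856607, [⟨⟨(2319273310, -18605059, -249539), (-1025620116, 1717294, 114405),
    (-10932957861, -91504946, -2098068), (-11318343544, 12715737, 140220)⟩, [⟨8083, 1164, 19866,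
    -13889⟩, ⟨-13291, 548, -3679, 2694⟩, ⟨4021, 1685, -47, -3234⟩, ⟨-2935, -1295, 932, 2312⟩,
    ⟨-335, 40, -2516, 406⟩, ⟨14146, 9816, -54291, -8441⟩, ⟨-23708, 391, -143540, 26869⟩, ⟨-33642,
    -7245, -95076, 32235⟩, ⟨19855, 8478, -2401, -15850⟩, ⟨-9468, -3088, -12145, 8280⟩, ⟨5899, 1795,
    9368, -5256⟩, ⟨-17391, -5829, -20128, 15090⟩, ⟨-1171, -791, 4196, 715⟩, ⟨27381, 8840, 36395,
    -24012⟩, ⟨-2890, -1203, -88, 2331⟩, ⟨-5419, -1843, -5902, 4682⟩, ⟨4213, 1317, 6207, -3728⟩,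
    ⟨8515, 3452, 1535, -6937⟩, ⟨-23380, -8968, -11304, 19431⟩, ⟨5025, 1701, 5584, -4347⟩]⟩,
    ⟨⟨(1159718803, -23512434, -259307), (572462987, -767822, -48612), (-30698985433, -149377742,
    -3203039), (1132352063, -23455826, -254594)⟩, [⟨9380, -685, 1297, 9190⟩, ⟨-17047, 768, -26597,
    -16656⟩, ⟨4558, 79, -18505, 11743⟩, ⟨-6247, 2475, 8615, -16068⟩, ⟨6948, -71, 23138, 6766⟩,
    ⟨20699, -3828, -114686, 20496⟩, ⟨-21433, -32, -84103, -20848⟩, ⟨-36552, 2940, 8611, -35836⟩,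
    ⟨24881, -3344, -74021, 24519⟩, ⟨-11536, 1167, 14877, -11333⟩, ⟨5356, -931, -26633, 5297⟩,
    ⟨-23405, 1899, 6323, -22948⟩, ⟨-7218, -498, -53071, -6975⟩, ⟨32067, -3520, -55298, 31526⟩,
    ⟨-3161, 538, 15171, -3125⟩, ⟨-7513, 573, 162, -7363⟩, ⟨6289, -322, 7856, 6149⟩, ⟨9665, -1489,
    -38410, 9542⟩, ⟨-28499, 3549, 70514, -28058⟩, ⟨6998, -522, 402, 6857⟩]⟩, ⟨⟨(-8228585672,
    119667326, -246493), (6161829081, -114697474, 11696), (-15017376934, 34947846, -3113378),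
    (1874590963, -91263452, 736310)⟩, [⟨-47449, 37885, -68566, 45774⟩, ⟨68604, -64825, 91062,
    -70530⟩, ⟨-50344, 34002, -77728, 45887⟩, ⟨45022, -34518, 66208, -42815⟩, ⟨-19021, 24382,
    -20100, 22328⟩, ⟨-19902, 10254, -339334, 167341⟩, ⟨49887, -39821, 144740, -161911⟩, ⟨194825,
    -149891, 286086, -185498⟩, ⟨-268582, 191336, -406687, 249104⟩, ⟨58670, -41936, 88725, -54476⟩,
    ⟨-22020, 10346, -37633, 18112⟩, ⟨125339, -96113, 184307, -119201⟩, ⟨53201, -55080, 66753,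
    -56776⟩, ⟨-159391, 110117, -244108, 146347⟩, ⟨32545, -18657, 52919, -28226⟩, ⟨41479, -32192,
    60684, -39614⟩, ⟨-26733, 24241, -36304, 27043⟩, ⟨-91546, 54350, -147350, 80205⟩, ⟨227211,
    -145783, 356963, -203777⟩, ⟨-38080, 29796, -55517, 36473⟩]⟩, ⟨⟨(2191778775, -14095846, -96127),
    (-2706123053, 170715, 166576), (-19453310483, -135931986, -2988453), (-5661834820, 49528890,
    416936)⟩, [⟨8854, 3531, 15271, -23497⟩, ⟨-7474, -2348, -15809, 19551⟩, ⟨4997, 4744, -4070,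
    -14488⟩, ⟨-3324, -3209, 2955, 9660⟩, ⟨-1325, -1108, 385, 3776⟩, ⟨17615, 28234, -67444, -56210⟩,
    ⟨-26874, 6129, -124052, 63799⟩, ⟨-39360, -16053, -66240, 104609⟩, ⟨23890, 22810, -20058,
    -69326⟩, ⟨-11105, -9106, -5260, 21678⟩, ⟨10755, -732, -6549, -6169⟩, ⟨-25491, -10415, -42814,
    67757⟩, ⟨54, -199, 1109, -45⟩, ⟨32497, 22407, 12478, -90455⟩, ⟨-3956, -3884, 3815, 11527⟩,
    ⟨-5234, -3067, -4509, 14326⟩, ⟨3453, 1195, 6797, -9082⟩, ⟨11170, 10507, -8648, -32344⟩,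
    ⟨-27972, -23639, 9334, 79802⟩, ⟨4811, 2761, 4408, -13142⟩]⟩, ⟨⟨(838497752, -19168112, -134992),
    (-473832674, 1113363, 45060), (-37686631964, -155162173, -3610835), (7819379229, 20377084,
    162300)⟩, [⟨9419, 442, -4257, -9486⟩, ⟨-12140, -32, -36756, 12073⟩, ⟨5383, 566, -27050, -5511⟩,
    ⟨-4953, -295, 7166, 5006⟩, ⟨2424, -378, 37553, -2300⟩, ⟨25854, 2899, -144091, -26519⟩, ⟨-20339,
    98, -73393, 20184⟩, ⟨-39507, -2156, 41669, 39874⟩, ⟨29053, 2509, -103155, -29586⟩, ⟨-12875,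
    -868, 26581, 13042⟩, ⟨6521, 697, -33640, -6679⟩, ⟨-25464, -1406, 28167, 25705⟩, ⟨-6335, 385,
    -50722, 6186⟩, ⟨36173, 2621, -88945, -36693⟩, ⟨-4143, 52, 22834, 9622⟩, ⟨-6123, -1093, -584,
    12550⟩, ⟨4881, 74, 9969, -4871⟩, ⟨9535, 1413, -80167, -9879⟩, ⟨-32826, -2656, 102497, 33378⟩,
    ⟨7550, 386, -5946, -7613⟩]⟩]⟩

def box10 : Cert :=
  ⟨1937177180, 105670815, [⟨⟨(2352118484, -14296690, -213430), (-1028368363, 1073436, 69234),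
    (-10774061703, -68041049, -1491929), (-11340885481, 9852386, 129632)⟩, [⟨4569, 704, 11092,
    -7806⟩, ⟨-7976, 232, -2356, 1751⟩, ⟨2577, 1106, -32, -2077⟩, ⟨-1988, -896, 609, 1570⟩, ⟨-160,
    38, -1451, 207⟩, ⟨7495, 5219, -27502, -4570⟩, ⟨-11940, 93, -71277, 13455⟩, ⟨-28285, -6345,
    -78969, 27051⟩, ⟨20511, 8964, -2463, -16413⟩, ⟨-5148, -1725, -6566, 4505⟩, ⟨3334, 1042, 5275,
    -2972⟩, ⟨-9736, -3352, -11196, 8454⟩, ⟨-743, -500, 2491, 466⟩, ⟨36437, 12086, 48163, -31974⟩,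
    ⟨-1957, -834, -57, 1581⟩, ⟨-3824, -1336, -4125, 3306⟩, ⟨2533, 814, 3703, -2241⟩, ⟨4980, 2069,
    877, -4064⟩, ⟨-27151, -10677, -13003, 22597⟩, ⟨3296, 1146, 3642, -2854⟩]⟩, ⟨⟨(1201401738,
    -18219282, -239088), (573699546, -486665, -29633), (-30438894393, -111687183, -2308779),
    (1173947253, -18186337, -236335)⟩, [⟨5349, -406, 908, 5245⟩, ⟨-10294, 498, -15937, -10067⟩,
    ⟨2953, 36, -11600, 7537⟩, ⟨-4191, 1651, 5606, -10576⟩, ⟨4091, -55, 13520, 3987⟩, ⟨10981, -2036,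
    -58671, 10880⟩, ⟨-10946, 27, -42243, -10658⟩, ⟨-31043, 2576, 5912, -30460⟩, ⟨25909, -3538,
    -74718, 25553⟩, ⟨-6320, 654, 7731, -6214⟩, ⟨3063, -536, -14746, 3032⟩, ⟨-13185, 1103, 2972,
    -12938⟩, ⟨-4374, -283, -31639, -4232⟩, ⟨43037, -4816, -70779, 42345⟩, ⟨-2165, 371, 10050,
    -2142⟩, ⟨-5325, 422, 14, -5223⟩, ⟨3791, -206, 4742, 3710⟩, ⟨5710, -890, -21999, 5642⟩, ⟨-33370,
    4228, 79727, -32881⟩, ⟨4613, -357, 410, 4524⟩]⟩, ⟨⟨(-8445807197, 97232360, 245832),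
    (6369306849, -92555182, -371948), (-15090393132, 36780909, -1659643), (2042004792, -75697330,
    138217)⟩, [⟨-28630, 22834, -41164, 27640⟩, ⟨44255, -41361, 58615, -45246⟩, ⟨-33925, 23048,
    -52088, 31086⟩, ⟨31872, -24431, 46642, -30360⟩, ⟨-12092, 15127, -12854, 13953⟩, ⟨-12285, 6658,
    -182352, 91589⟩, ⟨27655, -22035, 77471, -84528⟩, ⟨174715, -134561, 255152, -166688⟩, ⟨-291584,
    208583, -439038, 271542⟩, ⟨33944, -24357, 51048, -31642⟩, ⟨-13322, 6435, -22615, 11120⟩,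
    ⟨74558, -57235, 109038, -71054⟩, ⟨34022, -34917, 42485, -36081⟩, ⟨-225979, 157001, -344100,
    208512⟩, ⟨23173, -13454, 37473, -20282⟩, ⟨31099, -24110, 45285, -29736⟩, ⟨-17160, 15438,
    -23224, 17295⟩, ⟨-56393, 33844, -90278, 49816⟩, ⟨278369, -180037, 434918, -251299⟩, ⟨-26500,
    20734, -38432, 25417⟩]⟩, ⟨⟨(2216949593, -11079302, -112469), (-2705913891, -312645, 91527),
    (-19216873476, -101417067, -2148576), (-5750037916, 38723323, 435183)⟩, [⟨5031, 2089, 8653,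
    -13421⟩, ⟨-4626, -1582, -9513, 12191⟩, ⟨3214, 3085, -2509, -9350⟩, ⟨-2269, -2213, 1932, 6616⟩,
    ⟨-723, -607, 164, 2064⟩, ⟨9382, 14868, -34222, -29895⟩, ⟨-13548, 2802, -61981, 32401⟩, ⟨-33185,
    -14047, -55847, 88643⟩, ⟨24790, 23932, -19961, -72182⟩, ⟨-6066, -5022, -3022, 11984⟩, ⟨6053,
    -317, -3424, -3743⟩, ⟨-14258, -6045, -23951, 38091⟩, ⟨-33, -181, 709, 163⟩, ⟨43399, 30423,
    17721, -121275⟩, ⟨-2682, -2660, 2485, 7840⟩, ⟨-3731, -2250, -3202, 10265⟩, ⟨2106, 776, 4071,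
    -5574⟩, ⟨6550, 6232, -4855, -19031⟩, ⟨-32617, -27936, 9961, 93395⟩, ⟨3184, 1876, 2933,
    -8739⟩]⟩, ⟨⟨(872717147, -15060218, -152905), (-475704568, 774147, 29201), (-37417330044,
    -115272946, -2541414), (7783059541, 15959859, 172572)⟩, [⟨5399, 264, -2315, -5437⟩, ⟨-7431,
    -47, -21384, 7396⟩, ⟨3495, 371, -17061, -3575⟩, ⟨-3367, -209, 4912, 3404⟩, ⟨1454, -215, 21586,
    -1385⟩, ⟨13740, 1549, -73964, -14080⟩, ⟨-10435, 19, -36662, 10364⟩, ⟨-33665, -1896, 33799,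
    33973⟩, ⟨30357, 2666, -104687, -30898⟩, ⟨-7077, -488, 14082, 7166⟩, ⟨3739, 403, -18684, -3826⟩,
    ⟨-14394, -820, 15194, 14529⟩, ⟨-3861, 220, -30131, 3775⟩, ⟨48698, 3600, -115444, -49380⟩,
    ⟨-2837, 25, 15180, 6524⟩, ⟨-4386, -781, -239, 8815⟩, ⟨2972, 54, 5822, -2968⟩, ⟨5676, 842,
    -46247, -5871⟩, ⟨-38565, -3177, 116743, 39195⟩, ⟨4996, 265, -3753, -5037⟩]⟩]⟩

def box11 : Cert :=
  ⟨1733232513, 98273858, [⟨⟨(2378862900, -12452748, -221792), (-1030190894, 762545, 53508),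
    (-10648411300, -57761180, -1368087), (-11359376705, 8637931, 140883)⟩, [⟨4258, 692, 10241,
    -7244⟩, ⟨-7677, 147, -2382, 1788⟩, ⟨2646, 1157, -33, -2136⟩, ⟨-2069, -948, 615, 1639⟩, ⟨-146,
    55, -1600, 203⟩, ⟨8314, 5807, -29431, -5153⟩, ⟨-14003, 8, -82678, 15707⟩, ⟨-55880, -12948,
    -154557, 53363⟩, ⟨31843, 14176, -3775, -25528⟩, ⟨-5197, -1779, -6603, 4550⟩, ⟨3193, 1021, 5040,
    -2848⟩, ⟨-9699, -3411, -11102, 8427⟩, ⟨-801, -538, 2549, 512⟩, ⟨63202, 21424, 83213, -55488⟩,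
    ⟨-2192, -952, -63, 1774⟩, ⟨-4238, -1514, -4540, 3666⟩, ⟨4513, 1484, 6563, -3995⟩, ⟨5769, 2444,
    1001, -4715⟩, ⟨-46054, -18477, -21921, 38376⟩, ⟨5004, 1776, 5505, -4335⟩]⟩, ⟨⟨(1235598998,
    -15976393, -259701), (574531885, -351314, -23085), (-30232148373, -95276101, -2144665),
    (1208090727, -15954971, -257647)⟩, [⟨5020, -392, 987, 4926⟩, ⟨-9959, 509, -15353, -9747⟩,
    ⟨3060, 24, -11700, 7752⟩, ⟨-4332, 1700, 5644, -10766⟩, ⟨4584, -74, 15074, 4471⟩, ⟨12195, -2268,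
    -63272, 12090⟩, ⟨-12982, 74, -49483, -12650⟩, ⟨-61828, 5262, 9480, -60708⟩, ⟨40482, -5600,
    -113782, 39951⟩, ⟨-6420, 677, 7509, -6316⟩, ⟨2963, -521, -13891, 2934⟩, ⟨-13201, 1133, 2488,
    -12963⟩, ⟨-4552, -278, -32513, -4408⟩, ⟨75165, -8545, -118804, 74005⟩, ⟨-2448, 422, 11058,
    -2424⟩, ⟨-5923, 484, -87, -5814⟩, ⟨6772, -385, 8497, 6632⟩, ⟨6669, -1049, -25048, 6593⟩,
    ⟨-56984, 7324, 132254, -56184⟩, ⟨7032, -561, 813, 6901⟩]⟩, ⟨⟨(-8632032935, 88785130, 588708),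
    (6546078756, -84046320, -665461), (-15167030408, 39380731, -1044164), (2188162900, -70229293,
    -211770)⟩, [⟨-28178, 22454, -40349, 27224⟩, ⟨45226, -41913, 59794, -46056⟩, ⟨-36362, 24821,
    -55576, 33461⟩, ⟨34467, -26418, 50237, -32878⟩, ⟨-14431, 17715, -15410, 16441⟩, ⟨-15325, 8586,
    -205052, 104521⟩, ⟨35069, -27904, 95570, -102269⟩, ⟨364311, -280808, 529673, -348157⟩,
    ⟨-472130, 338842, -707618, 441117⟩, ⟨36102, -25985, 54046, -33761⟩, ⟨-13507, 6667, -22802,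
    11403⟩, ⟨78153, -60046, 113792, -74610⟩, ⟨37046, -37752, 46091, -39101⟩, ⟨-413348, 288456,
    -626446, 382901⟩, ⟨27088, -15887, 43603, -23880⟩, ⟨36263, -28092, 52603, -34711⟩, ⟨-32302,
    28883, -43598, 32472⟩, ⟨-68257, 41322, -108778, 60692⟩, ⟨494055, -321575, 768365, -448335⟩,
    ⟨-42278, 33078, -61054, 40601⟩]⟩, ⟨⟨(2237858780, -9820344, -135893), (-2704993121, -584816,
    62114), (-19029327617, -86335992, -1988094), (-5822973698, 34190526, 502428)⟩, [⟨4708, 2018,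
    8086, -12612⟩, ⟨-4561, -1659, -9187, 12087⟩, ⟨3311, 3208, -2493, -9658⟩, ⟨-2376, -2338, 1952,
    6949⟩, ⟨-759, -639, 131, 2170⟩, ⟨10448, 16422, -36661, -33262⟩, ⟨-15903, 3014, -72263, 38257⟩,
    ⟨-65710, -28649, -110658, 176232⟩, ⟨38622, 37628, -30015, -112763⟩, ⟨-6147, -5131, -3185,
    12256⟩, ⟨5778, -229, -3068, -3781⟩, ⟨-14195, -6198, -23864, 38075⟩, ⟨-89, -239, 765, 327⟩,
    ⟨75494, 53647, 32340, -211629⟩, ⟨-3007, -3008, 2694, 8813⟩, ⟨-4169, -2572, -3573, 11513⟩,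
    ⟨3795, 1468, 7242, -10095⟩, ⟨7603, 7303, -5431, -22153⟩, ⟨-55508, -48072, 15665, 159412⟩,
    ⟨4867, 2929, 4508, -13410⟩]⟩, ⟨⟨(901141416, -13351979, -183334), (-477091121, 616969, 24299),
    (-37204488361, -97836111, -2316699), (7752973878, 14115660, 201484)⟩, [⟨5088, 257, -2075,
    -5125⟩, ⟨-7267, -68, -20114, 7238⟩, ⟨3629, 389, -17295, -3709⟩, ⟨-3518, -226, 5146, 3556⟩,
    ⟨1654, -234, 23742, -1581⟩, ⟨15284, 1731, -79977, -15649⟩, ⟨-12423, -7, -42771, 12344⟩,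
    ⟨-67238, -3885, 64678, 67846⟩, ⟨47565, 4234, -160115, -48394⟩, ⟨-7208, -507, 13906, 7298⟩,
    ⟨3623, 393, -17643, -3705⟩, ⟨-14454, -845, 14649, 14587⟩, ⟨-4036, 218, -30880, 3951⟩, ⟨85273,
    6408, -196073, -86441⟩, ⟨-3207, 19, 16751, 7319⟩, ⟨-4920, -874, -134, 9736⟩, ⟨5352, 110, 10163,
    -5347⟩, ⟨6668, 990, -52976, -6890⟩, ⟨-66037, -5521, 194831, 67091⟩, ⟨7639, 417, -5501,
    -7701⟩]⟩]⟩

def box12 : Cert :=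
  ⟨1554988308, 79970352, [⟨⟨(2400683631, -9430544, -168450), (-1031404857, 471982, 31128),
    (-10548221704, -42865039, -950534), (-11374552380, 6575674, 110147)⟩, [⟨2193, 371, 5238,
    -3720⟩, ⟨-4108, 45, -1324, 1000⟩, ⟨1436, 638, -17, -1161⟩, ⟨-1174, -546, 340, 932⟩, ⟨-59, 32,
    -780, 89⟩, ⟨5044, 3532, -17347, -3166⟩, ⟨-8308, -44, -48636, 9286⟩, ⟨-40285, -9580, -110618,
    38425⟩, ⟨21962, 9925, -2565, -17634⟩, ⟨-2573, -896, -3260, 2253⟩, ⟨1644, 535, 2591, -1467⟩,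
    ⟨-4922, -1761, -5616, 4279⟩, ⟨-426, -286, 1302, 276⟩, ⟨43993, 15176, 57761, -38640⟩, ⟨-1201,
    -530, -35, 973⟩, ⟨-2413, -877, -2571, 2088⟩, ⟨1963, 657, 2844, -1739⟩, ⟨2794, 1202, 480,
    -2286⟩, ⟨-31626, -12894, -14995, 26379⟩, ⟨2443, 882, 2680, -2118⟩]⟩, ⟨⟨(1263670365, -12164863,
    -203087), (575095926, -221532, -13548), (-30066541142, -71005411, -1507700), (1236129655,
    -12153033, -201936)⟩, [⟨2601, -208, 570, 2554⟩, ⟨-5352, 286, -8233, -5241⟩, ⟨1673, 7, -6255,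
    4213⟩, ⟨-2445, 956, 3114, -6002⟩, ⟨2264, -41, 7422, 2210⟩, ⟨7407, -1381, -37520, 7346⟩, ⟨-7772,
    64, -29352, -7578⟩, ⟨-44867, 3896, 5506, -44078⟩, ⟨28066, -3924, -77227, 27712⟩, ⟨-3194, 342,
    3597, -3144⟩, ⟨1538, -272, -7056, 1524⟩, ⟨-6727, 589, 1063, -6609⟩, ⟨-2358, -137, -16676,
    -2284⟩, ⟨52613, -6059, -80439, 51828⟩, ⟨-1351, 234, 5970, -1338⟩, ⟨-3382, 283, -102, -3322⟩,
    ⟨2953, -174, 3719, 2893⟩, ⟨3250, -515, -11957, 3215⟩, ⟨-39344, 5115, 89145, -38812⟩, ⟨3444,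
    -281, 476, 3382⟩]⟩, ⟨⟨(-8790727393, 69963416, 640316), (6695963382, -65932244, -667200),
    (-15241461573, 34541585, -421882), (2314484072, -56033158, -365315)⟩, [⟨-15194, 12099, -21684,
    14689⟩, ⟨25431, -23413, 33573, -25822⟩, ⟨-20456, 14017, -31148, 18888⟩, ⟨20202, -15484, 29349,
    -19295⟩, ⟨-7508, 9081, -8046, 8471⟩, ⟨-10195, 5845, -125973, 64983⟩, ⟨22181, -17631, 59139,
    -62326⟩, ⟨274750, -211908, 398018, -262934⟩, ⟨-337399, 242781, -503780, 316068⟩, ⟨18669,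
    -13470, 27843, -17502⟩, ⟨-7293, 3661, -12255, 6212⟩, ⟨41390, -31821, 60046, -39570⟩, ⟨19930,
    -20193, 24725, -20958⟩, ⟨-300780, 210644, -454081, 279502⟩, ⟨15384, -9097, 24668, -13640⟩,
    ⟨21540, -16678, 31149, -20639⟩, ⟨-14711, 13091, -19812, 14761⟩, ⟨-34296, 20908, -54451, 30654⟩,
    ⟨352445, -230581, 546051, -321161⟩, ⟨-21517, 16834, -30965, 20685⟩]⟩, ⟨⟨(2255185664, -7539357,
    -112808), (-2703746004, -634932, 30064), (-18879400558, -64219658, -1391585), (-5883210708,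
    26173433, 407279)⟩, [⟨2434, 1070, 4177, -6542⟩, ⟨-2486, -947, -4933, 6619⟩, ⟨1801, 1759, -1316,
    -5266⟩, ⟨-1355, -1343, 1079, 3971⟩, ⟨-354, -299, 45, 1016⟩, ⟨6358, 9933, -21623, -20229⟩,
    ⟨-9443, 1657, -42690, 22825⟩, ⟨-47461, -21189, -80005, 127702⟩, ⟨26713, 26224, -20147, -78166⟩,
    ⟨-3052, -2565, -1632, 6129⟩, ⟨2968, -86, -1492, -2028⟩, ⟨-7201, -3219, -12118, 19377⟩, ⟨-69,
    -145, 406, 235⟩, ⟨52672, 37852, 23435, -148028⟩, ⟨-1649, -1661, 1436, 4842⟩, ⟨-2388, -1500,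
    -2047, 6617⟩, ⟨1666, 669, 3149, -4449⟩, ⟨3688, 3570, -2553, -10769⟩, ⟨-38219, -33401, 10059,
    110020⟩, ⟨2389, 1462, 2224, -6603⟩]⟩, ⟨⟨(924705047, -10256025, -151991), (-478131410, 431978,
    15320), (-37034775781, -72618536, -1604730), (7728085878, 10822486, 164635)⟩, [⟨2646, 137,
    -1030, -2665⟩, ⟨-3939, -46, -10578, 3925⟩, ⟨1987, 214, -9285, -2030⟩, ⟨-2003, -132, 2929,
    2024⟩, ⟨827, -112, 11558, -792⟩, ⟨9295, 1057, -47528, -9511⟩, ⟨-7460, -19, -25293, 7417⟩,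
    ⟨-48906, -2884, 45339, 49344⟩, ⟨33054, 2975, -109061, -33619⟩, ⟨-3594, -257, 6756, 3638⟩,
    ⟨1883, 206, -8980, -1925⟩, ⟨-7383, -440, 7225, 7451⟩, ⟨-2098, 108, -15804, 2056⟩, ⟨59818, 4556,
    -134084, -60623⟩, ⟨-1770, 7, 9065, 4015⟩, ⟨-2829, -502, -25, 5529⟩, ⟨2349, 53, 4356, -2347⟩,
    ⟨3266, 485, -25418, -3372⟩, ⟨-45699, -3867, 131979, 46415⟩, ⟨3751, 210, -2602, -3782⟩]⟩]⟩

def box13 : Cert :=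
  ⟨1391348980, 83668981, [⟨⟨(2419248233, -9103622, -205671), (-1032246242, 369675, 29347),
    (-10464545322, -40691614, -1084199), (-11387525185, 6375299, 137319)⟩, [⟨2815, 493, 6684,
    -4761⟩, ⟨-5361, 22, -1782, 1352⟩, ⟨1915, 861, -22, -1550⟩, ⟨-1567, -737, 443, 1246⟩, ⟨-76, 58,
    -1226, 126⟩, ⟨8009, 5624, -26887, -5080⟩, ⟨-13663, -142, -79425, 15225⟩, ⟨-67117, -16311,
    -183213, 63958⟩, ⟨34795, 15923, -4001, -27975⟩, ⟨-3680, -1301, -4654, 3225⟩, ⟨2203, 727, 3467,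
    -1966⟩, ⟨-7020, -2549, -7990, 6104⟩, ⟨-622, -417, 1835, 407⟩, ⟨71395, 24995, 93543, -62728⟩,
    ⟨-1702, -760, -50, 1381⟩, ⟨-3350, -1236, -3556, 2900⟩, ⟨4681, 1591, 6759, -4145⟩, ⟨4723, 2059,
    808, -3868⟩, ⟨-51460, -21266, -24336, 42957⟩, ⟨4921, 1803, 5388, -4268⟩]⟩, ⟨⟨(1287672634,
    -11797062, -253322), (575494923, -177494, -12903), (-29927671746, -67661353, -1738406),
    (1260112259, -11789185, -252282)⟩, [⟨3355, -274, 801, 3295⟩, ⟨-7009, 387, -10773, -6867⟩,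
    ⟨2244, 3, -8235, 5625⟩, ⟨-3250, 1268, 4057, -7895⟩, ⟨3597, -73, 11765, 3513⟩, ⟨11774, -2200,
    -58442, 11681⟩, ⟨-12878, 135, -48284, -12563⟩, ⟨-75169, 6640, 7251, -73880⟩, ⟨44663, -6300,
    -120667, 44118⟩, ⟨-4589, 498, 4998, -4519⟩, ⟨2074, -368, -9346, 2056⟩, ⟨-9627, 857, 1270,
    -9463⟩, ⟨-3364, -187, -23600, -3261⟩, ⟨85789, -9989, -127414, 84545⟩, ⟨-1928, 336, 8358,
    -1910⟩, ⟨-4708, 402, -207, -4626⟩, ⟨7052, -429, 8920, 6913⟩, ⟨5525, -881, -19969, 5468⟩,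
    ⟨-64313, 8444, 142727, -63470⟩, ⟨6959, -579, 1099, 6837⟩]⟩, ⟨⟨(-8930863091, 69923570, 977358),
    (6827772667, -65645068, -978431), (-15313530045, 37359884, -157665), (2427298143, -56574974,
    -651748)⟩, [⟨-20287, 16146, -28871, 19625⟩, ⟨34639, -31718, 45671, -35092⟩, ⟨-28152, 19351,
    -42728, 26068⟩, ⟨27744, -21265, 40193, -26527⟩, ⟨-12471, 14901, -13405, 13963⟩, ⟨-17472, 10195,
    -202398, 105465⟩, ⟨38525, -30598, 100860, -104965⟩, ⟨476016, -367332, 687466, -456092⟩,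
    ⟨-551426, 397657, -820696, 517711⟩, ⟨27740, -20056, 41240, -26063⟩, ⟨-10183, 5183, -17040,
    8736⟩, ⟨61256, -47121, 88596, -58635⟩, ⟨29388, -29630, 36373, -30811⟩, ⟨-507306, 356331,
    -763333, 472659⟩, ⟨22507, -13399, 35968, -20050⟩, ⟨31034, -24019, 44757, -29762⟩, ⟨-36486,
    32338, -49042, 36555⟩, ⟨-59882, 36722, -94764, 53755⟩, ⟨592883, -389558, 915562, -542133⟩,
    ⟨-44950, 35167, -64498, 43252⟩]⟩, ⟨⟨(2270111518, -7360276, -146307), (-2702335846, -769997,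
    21048), (-18753912919, -61085827, -1597358), (-5934967212, 25493669, 520494)⟩, [⟨3133, 1407,
    5376, -8444⟩, ⟨-3295, -1303, -6459, 8803⟩, ⟨2406, 2365, -1712, -7049⟩, ⟨-1816, -1811, 1408,
    5331⟩, ⟨-536, -453, 46, 1539⟩, ⟨10123, 15739, -33527, -32191⟩, ⟨-15542, 2540, -69969, 37714⟩,
    ⟨-79203, -36071, -133666, 213685⟩, ⟨42424, 41918, -31166, -124368⟩, ⟨-4377, -3702, -2402,
    8843⟩, ⟨3968, -80, -1901, -2808⟩, ⟨-10266, -4681, -17298, 27699⟩, ⟨-125, -232, 589, 413⟩,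
    ⟨85647, 62143, 39323, -241218⟩, ⟨-2339, -2370, 1988, 6881⟩, ⟨-3334, -2127, -2860, 9262⟩, ⟨4001,
    1656, 7506, -10722⟩, ⟨6243, 6085, -4206, -18265⟩, ⟨-62326, -54898, 15387, 179779⟩, ⟨4837, 3003,
    4525, -13400⟩]⟩, ⟨⟨(945015546, -10019028, -197300), (-478952345, 388143, 15835), (-36892990558,
    -68966116, -1828117), (7706669968, 10556380, 211732)⟩, [⟨3423, 182, -1274, -3447⟩, ⟨-5196, -71,
    -13618, 5181⟩, ⟨2669, 290, -12267, -2726⟩, ⟨-2681, -181, 3913, 2710⟩, ⟨1328, -175, 18146,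
    -1274⟩, ⟨14792, 1688, -74163, -15129⟩, ⟨-12396, -51, -41508, 12328⟩, ⟨-82101, -4925, 73645,
    82830⟩, ⟨52705, 4788, -170922, -53591⟩, ⟨-5174, -374, 9507, 5237⟩, ⟨2544, 279, -11912, -2599⟩,
    ⟨-10588, -642, 10043, 10684⟩, ⟨-3003, 149, -22328, 2945⟩, ⟨97718, 7528, -214252, -99013⟩,
    ⟨-2526, 5, 12716, 5699⟩, ⟨-3961, -701, 17, 7662⟩, ⟨5641, 137, 10267, -5639⟩, ⟨5575, 830,
    -42636, -5752⟩, ⟨-74848, -6398, 212211, 76002⟩, ⟨7596, 433, -5093, -7657⟩]⟩]⟩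

def box14 : Cert :=
  ⟨1229867852, 77812152, [⟨⟨(2436026744, -7691515, -195342), (-1032856412, 247160, 21166),
    (-10390101018, -33876320, -973463), (-11399297939, 5407165, 132597)⟩, [⟨2157, 389, 5095,
    -3639⟩, ⟨-4218, -9, -1441, 1097⟩, ⟨1514, 689, -15, -1227⟩, ⟨-1273, -605, 352, 1014⟩, ⟨-48, 51,
    -959, 89⟩, ⟨7367, 5186, -24203, -4715⟩, ⟨-12768, -192, -73775, 14191⟩, ⟨-62148, -15398,
    -168783, 59172⟩, ⟨31541, 14596, -3565, -25388⟩, ⟨-3111, -1114, -3927, 2727⟩, ⟨1838, 615, 2889,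
    -1640⟩, ⟨-5501, -2024, -6250, 4786⟩, ⟨-499, -336, 1431, 330⟩, ⟨65200, 23131, 85285, -57303⟩,
    ⟨-1365, -617, -41, 1109⟩, ⟨-2738, -1023, -2897, 2371⟩, ⟨3801, 1310, 5475, -3367⟩, ⟨3735, 1648,
    637, -3062⟩, ⟨-46754, -19558, -22074, 39058⟩, ⟨4044, 1501, 4420, -3509⟩]⟩, ⟨⟨(1309460120,
    -10008226, -244779), (575791892, -122326, -9428), (-29803667211, -56530963, -1577156),
    (1281888137, -10004234, -244071)⟩, [⟨2581, -214, 664, 2537⟩, ⟨-5533, 315, -8504, -5424⟩, ⟨1783,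
    -2, -6433, 4451⟩, ⟨-2632, 1024, 3224, -6334⟩, ⟨2842, -62, 9278, 2776⟩, ⟨10842, -2030, -52839,
    10760⟩, ⟨-12117, 151, -45153, -11826⟩, ⟨-69952, 6274, 5073, -68780⟩, ⟨40646, -5781, -107995,
    40165⟩, ⟨-3893, 427, 4110, -3836⟩, ⟨1740, -310, -7714, 1725⟩, ⟨-7569, 684, 818, -7443⟩, ⟨-2652,
    -142, -18474, -2571⟩, ⟨78680, -9253, -113771, 77568⟩, ⟨-1554, 272, 6625, -1541⟩, ⟨-3857, 336,
    -220, -3792⟩, ⟨5736, -358, 7288, 5625⟩, ⟨4392, -705, -15618, 4347⟩, ⟨-58674, 7773, 127761,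
    -57927⟩, ⟨5734, -485, 1010, 5635⟩]⟩, ⟨⟨(-9061819854, 61005022, 1095408), (6950505859,
    -57077431, -1069308), (-15385826274, 34735895, 143200), (2533733939, -49801349, -793936)⟩,
    [⟨-16117, 12820, -22878, 15600⟩, ⟨28347, -25835, 37332, -28665⟩, ⟨-22907, 15791, -34666,
    21266⟩, ⟨23156, -17749, 33462, -22163⟩, ⟨-10260, 12128, -11056, 11411⟩, ⟨-17195, 10180,
    -188331, 99029⟩, ⟨37833, -30028, 97459, -100308⟩, ⟨456927, -352763, 658067, -438281⟩, ⟨-514443,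
    371714, -763412, 483949⟩, ⟨24279, -17586, 35991, -22856⟩, ⟨-8821, 4545, -14707, 7615⟩, ⟨49676,
    -38232, 71649, -47604⟩, ⟨23883, -23974, 29500, -24974⟩, ⟨-480023, 338055, -720105, 448289⟩,
    ⟨18579, -11129, 29600, -16621⟩, ⟨26243, -20304, 37756, -25188⟩, ⟨-30725, 27137, -41228, 30746⟩,
    ⟨-48799, 30084, -76993, 43974⟩, ⟨555498, -366406, 855264, -509517⟩, ⟨-38196, 29883, -54661,
    36784⟩]⟩, ⟨⟨(2283744407, -6280265, -145487), (-2700786245, -770100, 7800), (-18642055751,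
    -50948197, -1442476), (-5982141282, 21711040, 512226)⟩, [⟨2406, 1102, 4129, -6502⟩, ⟨-2628,
    -1073, -5101, 7043⟩, ⟨1905, 1884, -1322, -5591⟩, ⟨-1481, -1485, 1120, 4355⟩, ⟨-405, -343, 19,
    1163⟩, ⟨9333, 14454, -30188, -29669⟩, ⟨-14536, 2217, -65207, 35397⟩, ⟨-73448, -34050, -124113,
    198638⟩, ⟨38538, 38304, -27626, -113163⟩, ⟨-3708, -3153, -2083, 7530⟩, ⟨3304, -39, -1512,
    -2410⟩, ⟨-8043, -3733, -13572, 21755⟩, ⟨-117, -201, 470, 381⟩, ⟨78354, 57350, 36991, -221101⟩,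
    ⟨-1876, -1912, 1559, 5529⟩, ⟨-2738, -1770, -2353, 7624⟩, ⟨3270, 1390, 6097, -8790⟩, ⟨4944,
    4848, -3246, -14489⟩, ⟨-56740, -50334, 13167, 163960⟩, ⟨3992, 2510, 3752, -11083⟩]⟩,
    ⟨⟨(963579867, -8555375, -196558), (-479643731, 305955, 12804), (-36766782504, -57450378,
    -1641388), (7687122997, 9002325, 209506)⟩, [⟨2641, 143, -941, -2659⟩, ⟨-4129, -64, -10594,
    4118⟩, ⟨2123, 232, -9612, -2168⟩, ⟨-2185, -150, 3180, 2208⟩, ⟨1059, -135, 14186, -1018⟩,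
    ⟨13635, 1562, -67159, -13940⟩, ⟨-11692, -66, -38740, 11632⟩, ⟨-76544, -4663, 66556, 77219⟩,
    ⟨48052, 4403, -153387, -48848⟩, ⟨-4398, -322, 7912, 4450⟩, ⟨2137, 236, -9847, -2183⟩, ⟨-8340,
    -514, 7681, 8415⟩, ⟨-2374, 113, -17453, 2330⟩, ⟨89773, 6987, -192869, -90947⟩, ⟨-2037, 0,
    10097, 4575⟩, ⟨-3262, -577, 46, 6252⟩, ⟨4611, 119, 8261, -4611⟩, ⟨4448, 662, -33483, -4586⟩,
    ⟨-68407, -5902, 190697, 69448⟩, ⟨6271, 364, -4069, -6322⟩]⟩]⟩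

def box15 : Cert :=
  ⟨1079690402, 72365302, [⟨⟨(2450124433, -6424119, -182169), (-1033259501, 160971, 14895),
    (-10328385252, -27953694, -868972), (-11409224501, 4530582, 125210)⟩, [⟨1557, 288, 3662,
    -2622⟩, ⟨-3131, -23, -1094, 835⟩, ⟨1125, 517, -10, -912⟩, ⟨-977, -468, 265, 779⟩, ⟨-27, 39,
    -675, 57⟩, ⟨6197, 4371, -19993, -3994⟩, ⟨-10849, -205, -62370, 12031⟩, ⟨-52374, -13187,
    -141650, 49831⟩, ⟨26287, 12280, -2923, -21180⟩, ⟨-2381, -862, -3002, 2088⟩, ⟨1418, 480, 2228,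
    -1266⟩, ⟨-3964, -1474, -4497, 3449⟩, ⟨-370, -249, 1035, 247⟩, ⟨54471, 19539, 71164, -47885⟩,
    ⟨-1016, -464, -32, 826⟩, ⟨-2095, -792, -2210, 1814⟩, ⟨2592, 904, 3726, -2296⟩, ⟨2617, 1166,
    445, -2147⟩, ⟨-38874, -16426, -18335, 32495⟩, ⟨2874, 1078, 3139, -2495⟩]⟩, ⟨⟨(1327835647,
    -8387844, -231307), (575994890, -82848, -6744), (-29700519740, -46793305, -1420831),
    (1300258374, -8386353, -230848)⟩, [⟨1870, -157, 510, 1838⟩, ⟨-4118, 241, -6333, -4038⟩, ⟨1331,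
    -5, -4733, 3311⟩, ⟨-2013, 782, 2426, -4808⟩, ⟨2016, -47, 6576, 1970⟩, ⟨9128, -1713, -43804,
    9061⟩, ⟨-10354, 146, -38396, -10109⟩, ⟨-59198, 5377, 3093, -58224⟩, ⟨33988, -4867, -89032,
    33596⟩, ⟨-2990, 331, 3073, -2946⟩, ⟨1349, -241, -5899, 1338⟩, ⟨-5468, 501, 480, -5378⟩, ⟨-1936,
    -100, -13412, -1878⟩, ⟨65967, -7823, -93226, 65055⟩, ⟨-1162, 204, 4884, -1153⟩, ⟨-2957, 261,
    -203, -2908⟩, ⟨3917, -250, 4997, 3842⟩, ⟨3090, -498, -10839, 3059⟩, ⟨-48953, 6534, 104885,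
    -48345⟩, ⟨4085, -351, 783, 4016⟩]⟩, ⟨⟨(-9175183952, 52375105, 1153551), (7056419849, -48863913,
    -1107797), (-15451999965, 31307848, 357006), (2626619623, -43069108, -877980)⟩, [⟨-11998, 9540,
    -16995, 11619⟩, ⟨21753, -19749, 28620, -21964⟩, ⟨-17454, 12060, -26347, 16237⟩, ⟨18175, -13933,
    26208, -17411⟩, ⟨-7534, 8827, -8136, 8335⟩, ⟨-15294, 9157, -160037, 84792⟩, ⟨33518, -26588,
    85194, -86891⟩, ⟨397079, -306675, 570540, -381228⟩, ⟨-439478, 318064, -650555, 414112⟩, ⟨19147,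
    -13890, 28314, -18054⟩, ⟨-7028, 3658, -11681, 6099⟩, ⟨36852, -28374, 53029, -35349⟩, ⟨17898,
    -17901, 22072, -18678⟩, ⟨-413369, 291751, -618537, 386793⟩, ⟨14181, -8538, 22535, -12731⟩,
    ⟨20668, -15987, 29675, -19852⟩, ⟨-21609, 19031, -28954, 21604⟩, ⟨-35077, 21720, -55201, 31709⟩,
    ⟨474216, -313801, 728263, -436074⟩, ⟨-27939, 21858, -39893, 26926⟩]⟩, ⟨⟨(2295302283, -5288007,
    -140317), (-2699282904, -726865, -1573), (-18549166361, -42106487, -1293891), (-6022066400,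
    18252925, 490515)⟩, [⟨1740, 809, 2988, -4712⟩, ⟨-1972, -826, -3798, 5300⟩, ⟨1418, 1409, -963,
    -4166⟩, ⟨-1140, -1148, 844, 3355⟩, ⟨-276, -234, 4, 794⟩, ⟨7864, 12143, -24940, -24995⟩,
    ⟨-12359, 1772, -55283, 30183⟩, ⟨-61974, -29159, -104858, 167945⟩, ⟨32175, 32141, -22583,
    -94611⟩, ⟨-2843, -2430, -1628, 5799⟩, ⟨2545, -12, -1119, -1902⟩, ⟨-5794, -2729, -9790, 15703⟩,
    ⟨-97, -158, 347, 311⟩, ⟨65557, 48338, 31670, -185286⟩, ⟨-1397, -1431, 1138, 4124⟩, ⟨-2103,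
    -1375, -1810, 5867⟩, ⟨2242, 974, 4160, -6040⟩, ⟨3467, 3418, -2227, -10176⟩, ⟨-47255, -42172,
    10374, 136755⟩, ⟨2847, 1810, 2688, -7921⟩]⟩, ⟨⟨(979330522, -7209066, -189978), (-480187612,
    240142, 10315), (-36662085218, -47438742, -1466429), (7670558459, 7577530, 201518)⟩, [⟨1917,
    105, -656, -1931⟩, ⟨-3090, -53, -7794, 3083⟩, ⟨1587, 174, -7091, -1620⟩, ⟨-1680, -117, 2437,
    1698⟩, ⟨757, -94, 9979, -729⟩, ⟨11490, 1320, -55748, -11742⟩, ⟨-10012, -69, -32891, 9963⟩,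
    ⟨-64878, -4004, 54896, 65446⟩, ⟨40242, 3714, -126742, -40900⟩, ⟨-3382, -250, 5976, 3422⟩,
    ⟨1659, 184, -7539, -1694⟩, ⟨-6035, -377, 5416, 6089⟩, ⟨-1738, 80, -12656, 1706⟩, ⟨75377, 5918,
    -159151, -76352⟩, ⟨-1524, -2, 7456, 3410⟩, ⟨-2512, -444, 53, 4777⟩, ⟨3162, 85, 5594, -3162⟩,
    ⟨3139, 468, -23319, -3234⟩, ⟨-57160, -4970, 157067, 58020⟩, ⟨4475, 263, -2821, -4511⟩]⟩]⟩

def box16 : Cert :=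
  ⟨931612908, 75712197, [⟨⟨(2462489877, -5915134, -212541), (-1033531132, 111686, 12730),
    (-10274858561, -25472456, -978062), (-11417957230, 4183135, 147567)⟩, [⟨1750, 330, 4103,
    -2942⟩, ⟨-3580, -43, -1275, 974⟩, ⟨1279, 593, -10, -1038⟩, ⟨-1117, -540, 298, 892⟩, ⟨-27, 55,
    -876, 67⟩, ⟨7869, 5561, -24992, -5103⟩, ⟨-13929, -312, -79739, 15418⟩, ⟨-67453, -17222,
    -181792, 64140⟩, ⟨32886, 15488, -3599, -26521⟩, ⟨-2955, -1081, -3723, 2592⟩, ⟨1700, 581, 2671,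
    -1518⟩, ⟨-4905, -1842, -5559, 4270⟩, ⟨-455, -306, 1245, 305⟩, ⟨69112, 25032, 90207, -60771⟩,
    ⟨-1194, -549, -38, 972⟩, ⟨-2438, -930, -2567, 2112⟩, ⟨4174, 1470, 5992, -3698⟩, ⟨3597, 1617,
    612, -2953⟩, ⟨-49513, -21108, -23341, 41411⟩, ⟨4206, 1593, 4588, -3652⟩]⟩, ⟨⟨(1344005205,
    -7746460, -272803), (576138092, -60727, -5898), (-29610792694, -42760206, -1612619),
    (1316426604, -7746560, -272456)⟩, [⟨2109, -180, 605, 2073⟩, ⟨-4721, 282, -7264, -4630⟩, ⟨1520,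
    -8, -5335, 3769⟩, ⟨-2297, 891, 2727, -5449⟩, ⟨2636, -65, 8591, 2577⟩, ⟨11600, -2181, -54922,
    11517⟩, ⟨-13359, 208, -49344, -13047⟩, ⟨-76520, 7028, 2629, -75284⟩, ⟨42644, -6143, -110313,
    42164⟩, ⟨-3721, 416, 3733, -3668⟩, ⟨1625, -292, -7021, 1612⟩, ⟨-6783, 628, 475, -6673⟩, ⟨-2348,
    -117, -16187, -2278⟩, ⟨83961, -10030, -116249, 82823⟩, ⟨-1372, 242, 5694, -1361⟩, ⟨-3447, 309,
    -272, -3391⟩, ⟨6317, -410, 8093, 6199⟩, ⟨4262, -691, -14774, 4222⟩, ⟨-62540, 8402, 132088,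
    -61780⟩, ⟨5989, -521, 1232, 5889⟩]⟩, ⟨⟨(-9277243719, 49425420, 1482980), (7151518975,
    -45997698, -1407358), (-15514246851, 30734023, 642113), (2710809911, -40897946, -1166764)⟩,
    [⟨-13864, 11020, -19601, 13433⟩, ⟨25620, -23182, 33678, -25838⟩, ⟨-20298, 14055, -30574,
    18918⟩, ⟨21221, -16269, 30542, -20345⟩, ⟨-10155, 11807, -10985, 11184⟩, ⟨-20384, 12318,
    -205142, 109413⟩, ⟨44649, -35402, 112178, -113524⟩, ⟨525569, -406046, 753613, -504999⟩,
    ⟨-562095, 407382, -830250, 530413⟩, ⟨24404, -17727, 36011, -23043⟩, ⟨-8675, 4554, -14377,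
    7562⟩, ⟨46807, -36052, 67216, -44935⟩, ⟨22217, -22149, 27358, -23142⟩, ⟨-538816, 381011,
    -804437, 505024⟩, ⟨17049, -10311, 27029, -15351⟩, ⟨24684, -19091, 35377, -23725⟩, ⟨-35777,
    31433, -47879, 35743⟩, ⟨-49333, 30666, -77461, 44720⟩, ⟨618402, -410364, 947557, -569921⟩,
    ⟨-41936, 32809, -59763, 40442⟩]⟩, ⟨⟨(2305516433, -4902972, -168107), (-2697813309, -736693,
    -10362), (-18468483898, -38422037, -1462537), (-6057300567, 16902366, 584550)⟩, [⟨1960, 924,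
    3366, -5317⟩, ⟨-2276, -974, -4356, 6132⟩, ⟨1615, 1612, -1076, -4750⟩, ⟨-1307, -1322, 949,
    3852⟩, ⟨-349, -295, -6, 1002⟩, ⟨10002, 15404, -31175, -31783⟩, ⟨-15878, 2149, -70853, 38875⟩,
    ⟨-79905, -38082, -135367, 216918⟩, ⟨40315, 40450, -27766, -118689⟩, ⟨-3535, -3034, -2058,
    7235⟩, ⟨3049, 4, -1292, -2327⟩, ⟨-7169, -3420, -12129, 19463⟩, ⟨-129, -204, 424, 413⟩, ⟨83286,
    61811, 41044, -235724⟩, ⟨-1643, -1690, 1316, 4856⟩, ⟨-2456, -1622, -2118, 6863⟩, ⟨3628, 1605,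
    6706, -9795⟩, ⟨4771, 4724, -3004, -14017⟩, ⟨-60275, -54078, 12566, 174665⟩, ⟨4179, 2681, 3961,
    -11644⟩]⟩, ⟨⟨(993260397, -6689096, -228106), (-480636865, 208696, 10468), (-36571215623,
    -43259633, -1652806), (7655923366, 7024533, 241068)⟩, [⟨2166, 121, -714, -2182⟩, ⟨-3558, -65,
    -8847, 3551⟩, ⟨1813, 200, -8013, -1851⟩, ⟨-1925, -136, 2784, 1946⟩, ⟨997, -121, 12953, -960⟩,
    ⟨14613, 1683, -69976, -14930⟩, ⟨-12942, -103, -42216, 12881⟩, ⟨-83979, -5241, 69322, 84710⟩,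
    ⟨50559, 4695, -157350, -51377⟩, ⟨-4216, -314, 7329, 4265⟩, ⟨2000, 222, -8981, -2042⟩, ⟨-7497,
    -473, 6572, 7563⟩, ⟨-2112, 95, -15259, 2075⟩, ⟨96060, 7599, -199707, -97290⟩, ⟨-1799, -5, 8703,
    4012⟩, ⟨-2939, -519, 76, 5553⟩, ⟨5118, 144, 8962, -5119⟩, ⟨4342, 648, -31885, -4472⟩, ⟨-73123,
    -6402, 198379, 74211⟩, ⟨6570, 392, -4033, -6623⟩]⟩]⟩

def box17 : Cert :=
  ⟨785488373, 70412343, [⟨⟨(2473099532, -4716830, -193861), (-1033703451, 64175, 8158),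
    (-10229370300, -20134837, -866457), (-11425469083, 3343510, 135690)⟩, [⟨1121, 215, 2621,
    -1882⟩, ⟨-2367, -38, -857, 656⟩, ⟨846, 395, -6, -687⟩, ⟨-769, -374, 202, 615⟩, ⟨-12, 34, -510,
    36⟩, ⟨5726, 4054, -17943, -3732⟩, ⟨-10190, -258, -58128, 11261⟩, ⟨-48891, -12632, -131381,
    46466⟩, ⟨23897, 11333, -2577, -19286⟩, ⟨-1923, -709, -2421, 1686⟩, ⟨1146, 395, 1799, -1023⟩,
    ⟨-3012, -1140, -3411, 2623⟩, ⟨-290, -195, 778, 195⟩, ⟨49982, 18253, 65191, -43958⟩, ⟨-777,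
    -360, -26, 633⟩, ⟨-1654, -636, -1739, 1433⟩, ⟨2168, 770, 3109, -1921⟩, ⟨2038, 923, 347, -1674⟩,
    ⟨-35619, -15299, -16788, 29805⟩, ⟨2358, 900, 2571, -2048⟩]⟩, ⟨⟨(1357917430, -6193004, -251012),
    (576235068, -37807, -3911), (-29534337942, -33884026, -1439208), (1330340132, -6194081,
    -250835)⟩, [⟨1355, -117, 405, 1332⟩, ⟨-3128, 190, -4818, -3069⟩, ⟨1009, -7, -3503, 2496⟩,
    ⟨-1577, 611, 1849, -3721⟩, ⟨1544, -39, 5028, 1509⟩, ⟨8447, -1590, -39531, 8388⟩, ⟨-9815, 165,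
    -36134, -9588⟩, ⟨-55637, 5159, 1052, -54751⟩, ⟨31064, -4498, -79490, 30722⟩, ⟨-2427, 273, 2383,
    -2393⟩, ⟨1099, -198, -4699, 1091⟩, ⟨-4174, 390, 228, -4108⟩, ⟨-1478, -72, -10149, -1435⟩,
    ⟨60883, -7319, -82805, 60071⟩, ⟨-896, 158, 3679, -889⟩, ⟨-2343, 212, -207, -2305⟩, ⟨3285, -217,
    4225, 3225⟩, ⟨2422, -394, -8310, 2400⟩, ⟨-45107, 6094, 94092, -44569⟩, ⟨3363, -295, 732,
    3308⟩]⟩, ⟨⟨(-9366849195, 40265822, 1461868), (7234821544, -37394040, -1375171), (-15570871600,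
    25845826, 761263), (2785151590, -33493809, -1177354)⟩, [⟨-9096, 7228, -12838, 8816⟩, ⟨17380,
    -15683, 22829, -17511⟩, ⟨-13695, 9500, -20588, 12783⟩, ⟨14869, -11400, 21366, -14265⟩, ⟨-6104,
    7051, -6613, 6698⟩, ⟨-15456, 9411, -150536, 80744⟩, ⟨33718, -26725, 83884, -84335⟩, ⟨390089,
    -301462, 558366, -375085⟩, ⟨-416398, 302152, -613891, 393409⟩, ⟨16248, -11816, 23930, -15360⟩,
    ⟨-5992, 3169, -9907, 5242⟩, ⟨29402, -22653, 42148, -28247⟩, ⟨14272, -14189, 17554, -14845⟩,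
    ⟨-398906, 282533, -594404, 374425⟩, ⟨11317, -6870, 17905, -10216⟩, ⟨17128, -13245, 24509,
    -16472⟩, ⟨-19035, 16689, -25446, 19005⟩, ⟨-28514, 17783, -44684, 25908⟩, ⟨454093, -302054,
    694437, -419278⟩, ⟨-24036, 18805, -34196, 23193⟩]⟩, ⟨⟨(2314336482, -3932662, -156558),
    (-2696440145, -633495, -15810), (-18399829608, -30407214, -1300397), (-6087690556, 13543195,
    542232)⟩, [⟨1258, 600, 2161, -3416⟩, ⟨-1517, -661, -2888, 4095⟩, ⟨1070, 1072, -701, -3150⟩,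
    ⟨-901, -915, 644, 2659⟩, ⟨-198, -168, -9, 569⟩, ⟨7287, 11201, -22381, -23154⟩, ⟨-11623, 1493,
    -51762, 28518⟩, ⟨-57972, -27933, -98325, 157611⟩, ⟨29334, 29544, -19870, -86448⟩, ⟨-2303,
    -1984, -1360, 4728⟩, ⟨2052, 13, -842, -1594⟩, ⟨-4402, -2123, -7457, 11969⟩, ⟨-88, -135, 268,
    279⟩, ⟨60299, 45002, 30222, -170867⟩, ⟨-1070, -1104, 844, 3165⟩, ⟨-1671, -1113, -1444, 4676⟩,
    ⟨1892, 850, 3486, -5118⟩, ⟨2705, 2689, -1674, -7956⟩, ⟨-43415, -39129, 8637, 125947⟩, ⟨2349,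
    1519, 2234, -6554⟩]⟩, ⟨⟨(1005297655, -5369023, -212882), (-481001644, 157929, 8377),
    (-36493935812, -34219746, -1466663), (7643287363, 5633926, 224339)⟩, [⟨1394, 79, -444, -1404⟩,
    ⟨-2367, -46, -5816, 2363⟩, ⟨1205, 133, -5272, -1229⟩, ⟨-1328, -95, 1913, 1342⟩, ⟨587, -70,
    7538, -566⟩, ⟨10648, 1230, -50415, -10876⟩, ⟨-9523, -85, -30883, 9480⟩, ⟨-61134, -3852, 49369,
    61663⟩, ⟨36873, 3443, -113578, -37464⟩, ⟨-2753, -207, 4718, 2784⟩, ⟨1354, 151, -6016, -1382⟩,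
    ⟨-4619, -294, 3966, 4660⟩, ⟨-1332, 58, -9559, 1309⟩, ⟨69734, 5552, -143037, -70619⟩, ⟨-1175,
    -4, 5630, 2614⟩, ⟨-2004, -354, 59, 3765⟩, ⟨2670, 77, 4636, -2671⟩, ⟨2473, 369, -17983, -2547⟩,
    ⟨-52801, -4650, 141667, 53580⟩, ⟨3694, 222, -2214, -3724⟩]⟩]⟩

def box18 : Cert :=
  ⟨641407120, 73668914, [⟨⟨(2481927192, -4086097, -221570), (-1033804241, 37722, 6175),
    (-10191822824, -17317553, -967638), (-11431732581, 2902001, 156074)⟩, [⟨1091, 213, 2545,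
    -1831⟩, ⟨-2357, -45, -864, 662⟩, ⟨836, 392, -5, -679⟩, ⟨-771, -377, 200, 617⟩, ⟨-9, 37, -530,
    34⟩, ⟨6170, 4375, -19123, -4039⟩, ⟨-11038, -307, -62778, 12182⟩, ⟨-53063, -13845, -142254,
    50410⟩, ⟨25532, 12179, -2717, -20619⟩, ⟨-1964, -729, -2471, 1723⟩, ⟨1168, 405, 1833, -1043⟩,
    ⟨-3096, -1180, -3504, 2696⟩, ⟨-297, -200, 786, 201⟩, ⟨53748, 19763, 70068, -47278⟩, ⟨-777,
    -362, -26, 633⟩, ⟨-1665, -645, -1748, 1443⟩, ⟨2500, 894, 3580, -2215⟩, ⟨2187, 996, 373, -1797⟩,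
    ⟨-38384, -16590, -18092, 32131⟩, ⟨2602, 1000, 2836, -2260⟩]⟩, ⟨⟨(1369520107, -5376283,
    -288892), (576297571, -25113, -3128), (-29471084558, -29204486, -1617439), (1341945597,
    -5377930, -288817)⟩, [⟨1322, -115, 409, 1300⟩, ⟨-3119, 192, -4809, -3061⟩, ⟨999, -8, -3438,
    2466⟩, ⟨-1579, 611, 1831, -3709⟩, ⟨1613, -43, 5251, 1577⟩, ⟨9109, -1717, -42219, 9047⟩,
    ⟨-10668, 191, -39173, -10424⟩, ⟨-60541, 5657, 363, -59589⟩, ⟨33259, -4837, -84335, 32899⟩,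
    ⟨-2484, 281, 2395, -2449⟩, ⟨1124, -203, -4763, 1115⟩, ⟨-4297, 405, 179, -4230⟩, ⟨-1501, -71,
    -10277, -1458⟩, ⟨65617, -7930, -87908, 64754⟩, ⟨-899, 159, 3656, -892⟩, ⟨-2361, 216, -227,
    -2323⟩, ⟨3791, -253, 4891, 3722⟩, ⟨2606, -425, -8863, 2582⟩, ⟨-48713, 6612, 100559, -48140⟩,
    ⟨3716, -329, 847, 3656⟩]⟩, ⟨⟨(-9442890602, 35516907, 1776637), (7305377488, -32925997,
    -1660377), (-15620304109, 23375700, 1037015), (2848540630, -29670435, -1455000)⟩, [⟨-9034,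
    7177, -12735, 8760⟩, ⟨17676, -15914, 23204, -17795⟩, ⟨-13748, 9550, -20635, 12849⟩, ⟨15143,
    -11611, 21730, -14536⟩, ⟨-6519, 7491, -7071, 7131⟩, ⟨-17232, 10556, -163412, 88064⟩, ⟨37503,
    -29715, 92544, -92542⟩, ⟨431907, -333856, 617317, -415537⟩, ⟨-452199, 328458, -665626, 427666⟩,
    ⟨16920, -12316, 24881, -16011⟩, ⟨-6237, 3318, -10291, 5473⟩, ⟨30801, -23737, 44088, -29608⟩,
    ⟨14749, -14630, 18124, -15323⟩, ⟨-437503, 310284, -650863, 411137⟩, ⟨11503, -7005, 18169,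
    -10405⟩, ⟨17569, -13584, 25107, -16904⟩, ⟨-22388, 19596, -29902, 22343⟩, ⟨-31114, 19457,
    -48677, 28324⟩, ⟨497880, -331839, 760158, -460418⟩, ⟨-27026, 21144, -38395, 26090⟩]⟩,
    ⟨⟨(2321714270, -3423164, -181849), (-2695218740, -581923, -23890), (-18343097854, -26178811,
    -1456684), (-6113087281, 11778736, 627965)⟩, [⟨1226, 590, 2107, -3335⟩, ⟨-1520, -672, -2882,
    4109⟩, ⟨1057, 1063, -683, -3116⟩, ⟨-906, -922, 638, 2674⟩, ⟨-201, -171, -14, 579⟩, ⟨7862,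
    12065, -23851, -24977⟩, ⟨-12595, 1546, -56003, 30958⟩, ⟨-62969, -30617, -106913, 171407⟩,
    ⟨31376, 31702, -20957, -92545⟩, ⟨-2354, -2035, -1407, 4846⟩, ⟨2090, 23, -834, -1646⟩, ⟨-4524,
    -2202, -7672, 12316⟩, ⟨-95, -142, 274, 299⟩, ⟨64902, 48664, 32986, -184094⟩, ⟨-1070, -1108,
    833, 3168⟩, ⟨-1686, -1131, -1459, 4724⟩, ⟨2188, 996, 4022, -5928⟩, ⟨2904, 2897, -1771, -8550⟩,
    ⟨-46833, -42370, 8944, 135988⟩, ⟨2597, 1691, 2479, -7256⟩]⟩, ⟨⟨(1015373172, -4676315, -247735),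
    (-481290608, 130697, 8502), (-36430101485, -29451682, -1640791), (7632718060, 4903961,
    260501)⟩, [⟨1362, 78, -420, -1372⟩, ⟨-2369, -48, -5763, 2364⟩, ⟨1194, 133, -5182, -1218⟩,
    ⟨-1334, -96, 1915, 1348⟩, ⟨616, -72, 7837, -595⟩, ⟨11489, 1329, -53884, -11733⟩, ⟨-10365, -100,
    -33455, 10320⟩, ⟨-66589, -4229, 52777, 67164⟩, ⟨39517, 3706, -120672, -40145⟩, ⟨-2820, -213,
    4776, 2852⟩, ⟨1385, 155, -6103, -1413⟩, ⟨-4760, -306, 4016, 4802⟩, ⟨-1355, 58, -9674, 1332⟩,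
    ⟨75225, 6022, -152562, -76174⟩, ⟨-1179, -6, 5600, 2616⟩, ⟨-2025, -358, 65, 3787⟩, ⟨3089, 92,
    5327, -3090⟩, ⟨2666, 398, -19222, -2744⟩, ⟨-57077, -5051, 151721, 57913⟩, ⟨4087, 248, -2399,
    -4120⟩]⟩]⟩

def box19 : Cert :=
  ⟨490662110, 77076101, [⟨⟨(2489348757, -3308499, -251328), (-1033859145, 18414, 4099),
    (-10160462755, -13938629, -1077246), (-11437007717, 2353517, 177944)⟩, [⟨953, 188, 2219,
    -1598⟩, ⟨-2116, -47, -785, 601⟩, ⟨744, 351, -4, -605⟩, ⟨-702, -345, 180, 562⟩, ⟨-6, 34, -474,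
    29⟩, ⟨5977, 4243, -18353, -3926⟩, ⟨-10727, -321, -60867, 11826⟩, ⟨-51619, -13579, -138112,
    49021⟩, ⟨24587, 11785, -2585, -19866⟩, ⟨-1766, -659, -2221, 1549⟩, ⟨1065, 372, 1672, -952⟩,
    ⟨-2797, -1072, -3163, 2436⟩, ⟨-269, -181, 703, 183⟩, ⟨51916, 19199, 67653, -45673⟩, ⟨-693,
    -325, -24, 565⟩, ⟨-1510, -588, -1584, 1309⟩, ⟨2333, 840, 3340, -2068⟩, ⟨1993, 913, 340, -1638⟩,
    ⟨-37136, -16135, -17506, 31096⟩, ⟨2402, 928, 2617, -2087⟩]⟩, ⟨⟨(1379293735, -4360915, -329546),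
    (576337361, -15143, -2307), (-29418151062, -23548697, -1810412), (1351722757, -4362731,
    -329576)⟩, [⟨1157, -101, 368, 1138⟩, ⟨-2805, 175, -4329, -2753⟩, ⟨892, -8, -3044, 2197⟩,
    ⟨-1436, 555, 1650, -3359⟩, ⟨1449, -39, 4718, 1417⟩, ⟨8828, -1667, -40589, 8770⟩, ⟨-10398, 195,
    -38104, -10162⟩, ⟨-59021, 5552, -291, -58102⟩, ⟨32083, -4682, -80730, 31740⟩, ⟨-2237, 254,
    2125, -2206⟩, ⟨1028, -186, -4325, 1020⟩, ⟨-3886, 368, 120, -3826⟩, ⟨-1349, -62, -9207, -1310⟩,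
    ⟨63498, -7708, -83987, 62673⟩, ⟨-804, 142, 3245, -798⟩, ⟨-2144, 197, -220, -2110⟩, ⟨3541, -239,
    4582, 3478⟩, ⟨2380, -390, -8037, 2359⟩, ⟨-47214, 6434, 96607, -46667⟩, ⟨3436, -307, 813,
    3381⟩]⟩, ⟨⟨(-9507896490, 29202601, 2117972), (7365596889, -27032558, -1969424), (-15663526306,
    19611285, 1335932), (2902942770, -24482255, -1756388)⟩, [⟨-8027, 6376, -11302, 7786⟩, ⟨16163,
    -14524, 21206, -16262⟩, ⟨-12413, 8633, -18606, 11614⟩, ⟨13967, -10710, 20020, -13414⟩, ⟨-5967,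
    6828, -6480, 6513⟩, ⟨-17175, 10572, -159300, 86187⟩, ⟨37272, -29525, 91354, -90945⟩, ⟨427317,
    -330374, 610005, -411324⟩, ⟨-441526, 320975, -649057, 417926⟩, ⟨15466, -11267, 22714, -14648⟩,
    ⟨-5791, 3096, -9539, 5095⟩, ⟨28272, -21792, 40418, -27191⟩, ⟨13441, -13307, 16503, -13950⟩,
    ⟨-429711, 305098, -638399, 404213⟩, ⟨10406, -6354, 16413, -9430⟩, ⟨16196, -12522, 23121,
    -15590⟩, ⟨-21257, 18579, -28369, 21206⟩, ⟨-28769, 18032, -44945, 26231⟩, ⟨488831, -326350,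
    745310, -452632⟩, ⟨-25353, 19835, -35976, 24485⟩]⟩, ⟨⟨(2327944169, -2782781, -208937),
    (-2694136521, -493712, -32485), (-18295671039, -21088770, -1625853), (-6134516339, 9568719,
    719872)⟩, [⟨1072, 520, 1844, -2919⟩, ⟨-1372, -615, -2594, 3715⟩, ⟨942, 950, -601, -2778⟩,
    ⟨-826, -843, 575, 2440⟩, ⟨-177, -150, -15, 509⟩, ⟨7623, 11683, -22889, -24215⟩, ⟨-12246, 1444,
    -54380, 30145⟩, ⟨-61295, -30030, -104169, 167024⟩, ⟨30242, 30638, -19958, -89263⟩, ⟨-2119,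
    -1836, -1279, 4371⟩, ⟨1905, 28, -742, -1518⟩, ⟨-4086, -2004, -6935, 11134⟩, ⟨-89, -132, 246,
    280⟩, ⟨62738, 47226, 32258, -178102⟩, ⟨-955, -991, 735, 2829⟩, ⟨-1532, -1034, -1328, 4298⟩,
    ⟨2048, 942, 3757, -5555⟩, ⟨2648, 2649, -1595, -7803⟩, ⟨-45349, -41160, 8356, 131781⟩, ⟨2403,
    1573, 2299, -6718⟩]⟩, ⟨⟨(1023886012, -3803572, -285108), (-481523326, 101665, 8650),
    (-36376751547, -23719963, -1829779), (7623793135, 3986661, 299290)⟩, [⟨1193, 69, -359, -1202⟩,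
    ⟨-2136, -45, -5155, 2132⟩, ⟨1066, 119, -4595, -1087⟩, ⟨-1216, -88, 1741, 1229⟩, ⟨556, -64,
    7013, -537⟩, ⟨11141, 1291, -51838, -11375⟩, ⟨-10114, -104, -32522, 10072⟩, ⟨-64973, -4154,
    50671, 65531⟩, ⟨38151, 3592, -115650, -38754⟩, ⟨-2542, -193, 4262, 2571⟩, ⟨1268, 142, -5544,
    -1293⟩, ⟨-4309, -278, 3580, 4347⟩, ⟨-1219, 51, -8661, 1199⟩, ⟨72853, 5859, -146337, -73767⟩,
    ⟨-1054, -6, 4974, 2335⟩, ⟨-1843, -325, 62, 3433⟩, ⟨2892, 88, 4960, -2893⟩, ⟨2439, 365, -17465,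
    -2510⟩, ⟨-55366, -4919, 146017, 56172⟩, ⟨3782, 231, -2181, -3812⟩]⟩]⟩

def box20 : Cert :=
  ⟨323985046, 89600967, [⟨⟨(2495315802, -2563285, -349351), (-1033883581, 6730, 2534),
    (-10135383317, -10747992, -1475739), (-11441255131, 1825747, 248330)⟩, [⟨1032, 206, 2399,
    -1728⟩, ⟨-2359, -57, -883, 676⟩, ⟨812, 385, -4, -661⟩, ⟨-777, -383, 197, 622⟩, ⟨-4, 43, -583,
    33⟩, ⟨7167, 5093, -21845, -4721⟩, ⟨-12867, -406, -72869, 14173⟩, ⟨-62542, -16561, -167081,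
    59378⟩, ⟨29126, 14015, -3032, -23544⟩, ⟨-1985, -745, -2497, 1742⟩, ⟨1203, 422, 1888, -1074⟩,
    ⟨-3358, -1293, -3798, 2926⟩, ⟨-313, -212, 812, 214⟩, ⟨62098, 23069, 80898, -54636⟩, ⟨-770,
    -362, -27, 627⟩, ⟨-1675, -656, -1756, 1452⟩, ⟨3315, 1198, 4742, -2938⟩, ⟨2582, 1187, 441,
    -2124⟩, ⟨-44707, -19506, -21079, 37447⟩, ⟨3193, 1240, 3479, -2775⟩]⟩, ⟨⟨(1387164488, -3383482,
    -460100), (576360914, -8503, -1852), (-29375749356, -18185002, -2491083), (1359597134,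
    -3385188, -460268)⟩, [⟨1254, -111, 408, 1234⟩, ⟨-3131, 197, -4836, -3073⟩, ⟨975, -10, -3308,
    2399⟩, ⟨-1587, 613, 1809, -3699⟩, ⟨1787, -50, 5818, 1748⟩, ⟨10591, -2001, -48377, 10522⟩,
    ⟨-12501, 243, -45738, -12220⟩, ⟨-71636, 6774, -984, -70530⟩, ⟨38058, -5571, -95171, 37657⟩,
    ⟨-2519, 288, 2362, -2485⟩, ⟨1163, -210, -4863, 1154⟩, ⟨-4673, 445, 103, -4601⟩, ⟨-1565, -71,
    -10658, -1520⟩, ⟨76066, -9266, -99567, 75087⟩, ⟨-894, 159, 3586, -887⟩, ⟨-2381, 220, -258,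
    -2343⟩, ⟨5034, -343, 6529, 4944⟩, ⟨3089, -507, -10369, 3062⟩, ⟨-56923, 7782, 115644, -56270⟩,
    ⟨4571, -411, 1114, 4499⟩]⟩, ⟨⟨(-9560893639, 22908383, 3060688), (7414626872, -21181102,
    -2835264), (-15699399022, 15626990, 2036135), (2947436295, -19259637, -2561603)⟩, [⟨-8811,
    6997, -12394, 8548⟩, ⟨18286, -16407, 23981, -18389⟩, ⟨-13703, 9540, -20518, 12832⟩, ⟨15614,
    -11974, 22359, -15001⟩, ⟨-7470, 8516, -8118, 8136⟩, ⟨-21069, 13020, -192015, 104216⟩, ⟨45520,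
    -36052, 110966, -110078⟩, ⟨524889, -405874, 748547, -505444⟩, ⟨-528943, 384781, -776733,
    501009⟩, ⟨17625, -12847, 25857, -16703⟩, ⟨-6632, 3560, -10908, 5846⟩, ⟨34399, -26520, 49130,
    -33097⟩, ⟨15778, -15597, 19361, -16363⟩, ⟨-520995, 370240, -773162, 490466⟩, ⟨11681, -7147,
    18402, -10600⟩, ⟨18203, -14073, 25962, -17528⟩, ⟨-30616, 26730, -40836, 30534⟩, ⟨-37709, 23679,
    -58845, 34426⟩, ⟨595565, -398138, 907033, -552029⟩, ⟨-34137, 26708, -48395, 32980⟩]⟩,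
    ⟨⟨(2332971026, -2162823, -293307), (-2693229762, -396530, -51033), (-18257713563, -16272552,
    -2231885), (-6151796780, 7432991, 1008855)⟩, [⟨1162, 567, 1999, -3166⟩, ⟨-1537, -695, -2896,
    4164⟩, ⟨1029, 1040, -650, -3036⟩, ⟨-914, -936, 630, 2704⟩, ⟨-214, -181, -22, 617⟩, ⟨9147,
    14005, -27241, -29057⟩, ⟨-14694, 1675, -65183, 36212⟩, ⟨-74306, -36625, -126381, 202646⟩,
    ⟨35851, 36399, -23430, -105879⟩, ⟨-2385, -2071, -1450, 4927⟩, ⟨2149, 38, -821, -1729⟩, ⟨-4906,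
    -2421, -8335, 13382⟩, ⟨-107, -157, 286, 336⟩, ⟨75089, 56702, 38969, -213305⟩, ⟨-1060, -1102,
    809, 3142⟩, ⟨-1703, -1154, -1478, 4779⟩, ⟨2916, 1353, 5341, -7916⟩, ⟨3433, 3442, -2046,
    -10119⟩, ⟨-54633, -49715, 9771, 158858⟩, ⟨3198, 2103, 3067, -8950⟩]⟩, ⟨⟨(1030758398, -2957544,
    -400788), (-481703669, 76175, 10938), (-36334061488, -18300112, -2510507), (7616591425,
    3098633, 420180)⟩, [⟨1295, 75, -380, -1304⟩, ⟨-2389, -52, -5731, 2386⟩, ⟨1166, 130, -5000,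
    -1190⟩, ⟨-1346, -98, 1923, 1361⟩, ⟨688, -79, 8620, -665⟩, ⟨13371, 1552, -61816, -13650⟩,
    ⟨-12171, -132, -39019, 12121⟩, ⟨-78914, -5072, 60735, 79590⟩, ⟨45286, 4276, -136469, -45998⟩,
    ⟨-2864, -218, 4763, 2897⟩, ⟨1435, 161, -6238, -1463⟩, ⟨-5184, -337, 4254, 5230⟩, ⟨-1416, 58,
    -10023, 1392⟩, ⟨87328, 7049, -174048, -88417⟩, ⟨-1172, -7, 5501, 2593⟩, ⟨-2050, -362, 71,
    3807⟩, ⟨4118, 128, 7034, -4121⟩, ⟨3170, 474, -22570, -3261⟩, ⟨-66795, -5955, 175038, 67762⟩,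
    ⟨5035, 310, -2861, -5075⟩]⟩]⟩

def box21 : Cert :=
  ⟨109390735, 124993349, [⟨⟨(2499434862, -1215063, -693043), (-1033890222, 729, 778),
    (-10118139907, -5078315, -2898972), (-11444190301, 866213, 493955)⟩, [⟨1108, 222, 2573, -1855⟩,
    ⟨-2658, -69, -1000, 767⟩, ⟨879, 417, -3, -715⟩, ⟨-857, -423, 216, 686⟩, ⟨-3, 57, -754, 41⟩,
    ⟨8816, 6270, -26734, -5818⟩, ⟨-15759, -516, -89131, 17348⟩, ⟨-78029, -20755, -208235, 74067⟩,
    ⟨35200, 16982, -3638, -28462⟩, ⟨-2202, -828, -2768, 1932⟩, ⟨1359, 478, 2133, -1214⟩, ⟨-4236,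
    -1636, -4790, 3691⟩, ⟨-375, -253, 965, 256⟩, ⟨76068, 28349, 99080, -66933⟩, ⟨-850, -401, -30,
    693⟩, ⟨-1847, -725, -1935, 1601⟩, ⟨5019, 1820, 7177, -4448⟩, ⟨3574, 1648, 611, -2939⟩, ⟨-55408,
    -24244, -26129, 46417⟩, ⟨4511, 1756, 4913, -3920⟩]⟩, ⟨⟨(1392604236, -1605436, -915469),
    (576372788, -2975, -1852), (-29346559516, -8601053, -4908629), (1365039788, -1606342,
    -915972)⟩, [⟨1348, -119, 445, 1327⟩, ⟨-3530, 224, -5456, -3465⟩, ⟨1056, -12, -3569, 2597⟩,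
    ⟨-1749, 675, 1983, -4068⟩, ⟨2318, -65, 7545, 2267⟩, ⟨13032, -2464, -59258, 12948⟩, ⟨-15336,
    306, -56048, -14992⟩, ⟨-89481, 8492, -1774, -88109⟩, ⟨46039, -6752, -114632, 45557⟩, ⟨-2796,
    320, 2599, -2758⟩, ⟨1316, -238, -5482, 1306⟩, ⟨-5899, 564, 94, -5809⟩, ⟨-1865, -84, -12688,
    -1812⟩, ⟨93274, -11390, -121211, 92082⟩, ⟨-988, 176, 3949, -981⟩, ⟨-2626, 244, -294, -2585⟩,
    ⟨7626, -522, 9908, 7490⟩, ⟨4280, -703, -14309, 4243⟩, ⟨-70617, 9675, 142755, -69814⟩, ⟨6461,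
    -583, 1606, 6359⟩]⟩, ⟨⟨(-9597865745, 10953533, 6233613), (7448797418, -10119432, -5760139),
    (-15724753452, 7551025, 4285661), (2978549697, -9226665, -5248247)⟩, [⟨-9552, 7585, -13428,
    9268⟩, ⟨20812, -18654, 27285, -20922⟩, ⟨-14945, 10413, -22362, 14004⟩, ⟨17348, -13304, 24827,
    -16671⟩, ⟨-9789, 11134, -10645, 10649⟩, ⟨-26327, 16311, -237059, 128945⟩, ⟨56451, -44704,
    137101, -135674⟩, ⟨661120, -511272, 942181, -636803⟩, ⟨-644263, 468888, -945379, 610523⟩,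
    ⟨19726, -14385, 28919, -18703⟩, ⟨-7569, 4074, -12438, 6682⟩, ⟨43788, -33763, 62497, -42143⟩,
    ⟨18964, -18727, 23260, -19656⟩, ⟨-644227, 458096, -955313, 606805⟩, ⟨13004, -7968, 20469,
    -11811⟩, ⟨20245, -15651, 28857, -19499⟩, ⟨-46801, 40829, -62396, 46666⟩, ⟨-52610, 33077,
    -82033, 48071⟩, ⟨744256, -497997, 1132611, -690338⟩, ⟨-48654, 38066, -68930, 47015⟩]⟩,
    ⟨⟨(2336450341, -1027460, -585711), (-2692584787, -192551, -109150), (-18231600708, -7692259,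
    -4390611), (-6163752005, 3529805, 2012377)⟩, [⟨1248, 612, 2148, -3403⟩, ⟨-1736, -790, -3267,
    4708⟩, ⟨1114, 1127, -699, -3288⟩, ⟨-1009, -1034, 691, 2986⟩, ⟨-274, -232, -32, 790⟩, ⟨11257,
    17225, -33335, -35759⟩, ⟨-18001, 2004, -79797, 44398⟩, ⟨-92741, -45903, -157823, 253063⟩,
    ⟨43349, 44078, -28137, -128074⟩, ⟨-2646, -2301, -1618, 5472⟩, ⟨2427, 48, -915, -1966⟩, ⟨-6189,
    -3066, -10520, 16889⟩, ⟨-130, -190, 342, 410⟩, ⟨92020, 69640, 48063, -261522⟩, ⟨-1171, -1219,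
    888, 3472⟩, ⟨-1879, -1277, -1632, 5276⟩, ⟨4422, 2063, 8091, -12012⟩, ⟨4752, 4772, -2812,
    -14014⟩, ⟨-67741, -61753, 11861, 197056⟩, ⟨4522, 2983, 4343, -12662⟩]⟩, ⟨⟨(1035516942,
    -1405451, -801119), (-481824642, 35262, 20237), (-36304696274, -8649967, -4937356),
    (7611606579, 1472083, 839161)⟩, [⟨1393, 81, -403, -1403⟩, ⟨-2698, -60, -6444, 2694⟩, ⟨1264,
    141, -5398, -1289⟩, ⟨-1486, -109, 2119, 1502⟩, ⟨894, -102, 11155, -864⟩, ⟨16458, 1912, -75747,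
    -16799⟩, ⟨-14940, -168, -47799, 14879⟩, ⟨-98620, -6362, 75201, 99464⟩, ⟨54807, 5186, -164484,
    -55666⟩, ⟨-3180, -243, 5259, 3216⟩, ⟨1624, 183, -7033, -1657⟩, ⟨-6548, -427, 5326, 6605⟩,
    ⟨-1689, 69, -11928, 1661⟩, ⟨107131, 8669, -212362, -108463⟩, ⟨-1296, -8, 6061, 2865⟩, ⟨-2264,
    -400, 80, 4195⟩, ⟨6245, 196, 10638, -6249⟩, ⟨4395, 658, -31179, -4522⟩, ⟨-82902, -7407, 216287,
    84099⟩, ⟨7121, 440, -4005, -7178⟩]⟩]⟩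

/-- Certificates for boxes which cover the whole solution curve. -/
def certs : List Cert :=
  [box0, box1, box2, box3, box4, box5, box6, box7, box8, box9, box10, box11, box12, box13,
    box14, box15, box16, box17, box18, box19, box20, box21]

theorem covers_certs : covers scale certs = true := by decide +kernel

set_option maxHeartbeats 10000000 in
/-- All certificates are valid; the kernel evaluates the interval computations. -/
theorem check_of_mem_certs : ∀ c ∈ certs, c.check = true := by
  simp only [certs, List.forall_mem_cons, List.not_mem_nil, false_imp_iff, implies_true, and_true]
  refine ⟨?_, ?_, ?_, ?_, ?_, ?_, ?_, ?_, ?_, ?_, ?_, ?_, ?_, ?_, ?_, ?_, ?_, ?_, ?_, ?_, ?_, ?_⟩ <;>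
    decide +kernel

end

theorem lineDist_eq_of_isLeast {p₁ v₁ p₂ v₂ : EuclideanSpace ℝ (Fin 3)} {d : ℝ} (t₁ t₂ : ℝ)
    (h : dist (p₁ + t₁ • v₁) (p₂ + t₂ • v₂) = d)
    (hle : ∀ s₁ s₂ : ℝ, d ≤ dist (p₁ + s₁ • v₁) (p₂ + s₂ • v₂)) : lineDist p₁ v₁ p₂ v₂ = d :=
  IsLeast.csInf_eq ⟨⟨t₁, t₂, h.symm⟩, by rintro _ ⟨s₁, s₂, rfl⟩; exact hle s₁ s₂⟩

theorem lineDist_comm (p₁ v₁ p₂ v₂ : EuclideanSpace ℝ (Fin 3)) :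
    lineDist p₁ v₁ p₂ v₂ = lineDist p₂ v₂ p₁ v₁ := by
  rw [lineDist, lineDist]
  congr 1
  ext d
  exact ⟨fun ⟨s, t, h⟩ => ⟨t, s, h.trans (dist_comm _ _)⟩,
    fun ⟨s, t, h⟩ => ⟨t, s, h.trans (dist_comm _ _)⟩⟩

theorem lineDist_neg_left (p₁ v₁ p₂ v₂ : EuclideanSpace ℝ (Fin 3)) :
    lineDist p₁ (-v₁) p₂ v₂ = lineDist p₁ v₁ p₂ v₂ := by
  rw [lineDist, lineDist]
  congr 1
  ext d
  exact ⟨fun ⟨s, t, h⟩ => ⟨-s, t, by simpa using h⟩, fun ⟨s, t, h⟩ => ⟨-s, t, by simpa using h⟩⟩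

theorem lineDist_neg_right (p₁ v₁ p₂ v₂ : EuclideanSpace ℝ (Fin 3)) :
    lineDist p₁ v₁ p₂ (-v₂) = lineDist p₁ v₁ p₂ v₂ := by
  rw [lineDist_comm, lineDist_neg_left, lineDist_comm]

namespace Quad

/-- The point of a line at height zero. -/
noncomputable def point (x : Quad ℝ) : EuclideanSpace ℝ (Fin 3) := !₂[x.p, x.q, 0]

/-- The direction vector of a line, with slopes scaled by `ε`. -/
noncomputable def direction (ε : ℝ) (x : Quad ℝ) : EuclideanSpace ℝ (Fin 3) :=
  !₂[ε * x.a, ε * x.b, 1]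

variable {ε : ℝ} {x y : Quad ℝ}

theorem direction_ne_zero : direction ε x ≠ 0 := fun h => by
  simpa [direction] using congrArg (fun z : EuclideanSpace ℝ (Fin 3) => z 2) h

theorem linearIndependent_direction (hε : 0 < ε) (h : y.a - x.a ≠ 0 ∨ y.b - x.b ≠ 0) :
    LinearIndependent ℝ ![direction ε x, direction ε y] := by
  rw [LinearIndependent.pair_iff]
  intro s t hst
  have h0 : s * (ε * x.a) + t * (ε * y.a) = 0 := by
    simpa [direction] using congrArg (fun z : EuclideanSpace ℝ (Fin 3) => z 0) hst
  have h1 : s * (ε * x.b) + t * (ε * y.b) = 0 := by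
    simpa [direction] using congrArg (fun z : EuclideanSpace ℝ (Fin 3) => z 1) hst
  have h2 : s + t = 0 := by
    simpa [direction] using congrArg (fun z : EuclideanSpace ℝ (Fin 3) => z 2) hst
  have ht : t = 0 := by
    rcases h with h | h
    · exact (mul_eq_zero.1 (show t * (ε * (y.a - x.a)) = 0 by
        linear_combination h0 - ε * x.a * h2)).resolve_right (mul_ne_zero hε.ne' h)
    · exact (mul_eq_zero.1 (show t * (ε * (y.b - x.b)) = 0 by
        linear_combination h1 - ε * x.b * h2)).resolve_right (mul_ne_zero hε.ne' h)
  exact ⟨by linarith, ht⟩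

theorem dist_sq (ε s t : ℝ) (x y : Quad ℝ) :
    dist (x.point + s • x.direction ε) (y.point + t • y.direction ε) ^ 2 =
      (y.p - x.p + ε * (t * y.a - s * x.a)) ^ 2 + (y.q - x.q + ε * (t * y.b - s * x.b)) ^ 2
        + (t - s) ^ 2 := by
  rw [EuclideanSpace.dist_eq, Real.sq_sqrt (by positivity)]
  simp only [Fin.sum_univ_three, Real.dist_eq, sq_abs, point, direction]
  simp
  ring

theorem lineDist_eq_two (hε : 0 < ε) (h : y.a - x.a ≠ 0 ∨ y.b - x.b ≠ 0)
    (hxy : separation x y ^ 2 = 4 * ((y.a - x.a) ^ 2 + (y.b - x.b) ^ 2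
      + ε ^ 2 * (x.a * y.b - x.b * y.a) ^ 2)) :
    lineDist x.point (x.direction ε) y.point (y.direction ε) = 2 := by
  set u := y.a - x.a with hu
  set v := y.b - x.b with hv
  set w := x.a * y.b - x.b * y.a with hw
  set d := separation x y with hd
  have huv : 0 < u ^ 2 + v ^ 2 := by
    rcases h with h | h <;> positivity
  set N := u ^ 2 + v ^ 2 + ε ^ 2 * w ^ 2 with hN
  have hNpos : 0 < N := by positivity
  obtain ⟨k, hk⟩ : ∃ k, k * N = d := ⟨d / N, div_mul_cancel₀ _ hNpos.ne'⟩
  obtain ⟨s, hs⟩ : ∃ s, s * (ε * (u ^ 2 + v ^ 2)) =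
      u * (k * v + k * ε ^ 2 * w * y.a - (y.p - x.p))
        + v * (-k * u + k * ε ^ 2 * w * y.b - (y.q - x.q)) :=
    ⟨_ / (ε * (u ^ 2 + v ^ 2)), div_mul_cancel₀ _ (by positivity)⟩
  refine lineDist_eq_of_isLeast s (s - k * ε * w) ?_ fun s t => ?_
  · have h0 : y.p - x.p + ε * ((s - k * ε * w) * y.a - s * x.a) = k * v := by
      refine mul_left_cancel₀ huv.ne' ?_
      rw [separation] at hd
      linear_combination u * hs - v * hk - v * hd
    have h1 : y.q - x.q + ε * ((s - k * ε * w) * y.b - s * x.b) = -k * u := by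
      refine mul_left_cancel₀ huv.ne' ?_
      rw [separation] at hd
      linear_combination v * hs + u * hk + u * hd
    have h2 := dist_sq ε s (s - k * ε * w) x y
    rw [h0, h1] at h2
    refine (sq_eq_sq₀ dist_nonneg zero_le_two).1 (mul_right_cancel₀ hNpos.ne' ?_)
    rw [h2]
    linear_combination (k * N + d) * hk + hxy
  · refine (sq_le_sq₀ zero_le_two dist_nonneg).1 (le_of_mul_le_mul_right ?_ hNpos)
    rw [dist_sq]
    set X := y.p - x.p + ε * (t * y.a - s * x.a) with hX
    set Y := y.q - x.q + ε * (t * y.b - s * x.b) with hY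
    have hdot : X * v - Y * u - (t - s) * (ε * w) = d := by
      rw [hd, separation, hX, hY, hw, hu, hv]; ring
    have h4 : 2 ^ 2 * N = (X * v - Y * u - (t - s) * (ε * w)) ^ 2 := by
      rw [hdot]; linear_combination -hxy
    have lagrange : (X ^ 2 + Y ^ 2 + (t - s) ^ 2) * N = (X * v - Y * u - (t - s) * (ε * w)) ^ 2
        + ((X * u + Y * v) ^ 2 + (X * (ε * w) + (t - s) * v) ^ 2
          + (Y * (ε * w) - (t - s) * u) ^ 2) := by
      rw [hN]; ring
    rw [h4, lagrange]
    exact le_add_of_nonneg_right (by positivity)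

end Quad

theorem eq_zero_one_or_mem_pairs :
    ∀ i j : Fin 7, i < j → i = 0 ∧ j = 1 ∨ ((i : ℕ), (j : ℕ)) ∈ pairs := by
  decide

/-- The solution curve of the system of touching equations. -/
theorem exists_touching_quads {ε : ℝ} (hε : 0 < ε) (hε' : ε ≤ 1) :
    ∃ x : Fin 7 → Quad ℝ, x 0 = ⟨-1, 0, 0, -1⟩ ∧ x 1 = ⟨1, 0, 0, 1⟩ ∧ ∀ i j, i < j →
      ((x j).a - (x i).a ≠ 0 ∨ (x j).b - (x i).b ≠ 0) ∧
      separation (x i) (x j) ^ 2 = 4 * (((x j).a - (x i).a) ^ 2 + ((x j).b - (x i).b) ^ 2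
        + ε ^ 2 * ((x i).a * (x j).b - (x i).b * (x j).a) ^ 2) := by
  have hS : (0 : ℝ) < scale := by norm_num [scale]
  obtain ⟨c, hc, t, ht, hct⟩ := exists_mem_of_covers covers_certs (mul_pos hS hε)
    (mul_le_of_le_one_right hS.le hε')
  obtain ⟨x, hx0, hx1, hx⟩ := c.exists_touching (check_of_mem_certs c hc) ht
  simp only [hct, touching] at hx
  generalize (scale : ℝ) = S at *
  refine ⟨fun i => ⟨(x i).a / S, (x i).b / S, (x i).p / S, (x i).q / S⟩, ?_, ?_, ?_⟩
  · simp [hx0, hS.ne']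
  · simp [hx1, hS.ne']
  intro i j hij
  rcases eq_zero_one_or_mem_pairs i j hij with ⟨rfl, rfl⟩ | hmem
  · have h1 : S / S = 1 := div_self hS.ne'
    norm_num [hx0, hx1, neg_div, h1, separation]
  · obtain ⟨hsep, heq⟩ := hx _ hmem
    simp only [← sub_div, ne_eq, div_eq_zero_iff, hS.ne', or_false]
    refine ⟨hsep, ?_⟩
    simp only [separation] at *
    field_simp
    refine mul_left_cancel₀ (pow_ne_zero 2 hS.ne') ?_
    linear_combination heq

theorem angle_direction {ε θ : ℝ} (h0 : 0 < θ) (hpi : θ < Real.pi) (hε : ε = Real.tan (θ / 2)) :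
    InnerProductGeometry.angle (Quad.direction ε ⟨-1, 0, 0, -1⟩)
      (Quad.direction ε ⟨1, 0, 0, 1⟩) = θ := by
  have hcos : 0 < Real.cos (θ / 2) := Real.cos_pos_of_mem_Ioo ⟨by linarith, by linarith⟩
  have hnorm : ∀ x : Quad ℝ, ‖x.direction ε‖ ^ 2 = (ε * x.a) ^ 2 + (ε * x.b) ^ 2 + 1 := by
    intro x
    simp [Quad.direction, EuclideanSpace.norm_sq_eq, Fin.sum_univ_three]
  have hn : ‖Quad.direction ε ⟨-1, 0, 0, -1⟩‖ = ‖Quad.direction ε ⟨1, 0, 0, 1⟩‖ := by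
    rw [← sq_eq_sq₀ (norm_nonneg _) (norm_nonneg _), hnorm, hnorm]
    ring
  have hinner : inner ℝ (Quad.direction ε ⟨-1, 0, 0, -1⟩) (Quad.direction ε ⟨1, 0, 0, 1⟩)
      = 1 - ε ^ 2 := by
    simp [Quad.direction, PiLp.inner_apply, Fin.sum_univ_three]
    ring
  rw [InnerProductGeometry.angle, hn, ← sq, hnorm, hinner, ← Real.arccos_cos h0.le hpi.le]
  congr 1
  have hθ : Real.cos θ = Real.cos (θ / 2) ^ 2 - Real.sin (θ / 2) ^ 2 := by
    rw [← Real.cos_two_mul']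
    congr 1
    ring
  rw [hθ, hε, Real.tan_eq_sin_div_cos]
  have := Real.sin_sq_add_cos_sq (θ / 2)
  field_simp
  linear_combination -(Real.cos (θ / 2) ^ 2 - Real.sin (θ / 2) ^ 2) * this

theorem exists_configuration_of_le {θ : ℝ} (h0 : 0 < θ) (hθ : θ ≤ Real.pi / 2) :
    ∃ p v : Fin 7 → EuclideanSpace ℝ (Fin 3),
      (∀ i, v i ≠ 0) ∧
      (∀ i j, i ≠ j → LinearIndependent ℝ ![v i, v j]) ∧
      (∀ i j, i ≠ j → lineDist (p i) (v i) (p j) (v j) = 2) ∧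
      InnerProductGeometry.angle (v 0) (v 1) = θ := by
  have hpi := Real.pi_pos
  have hpos : 0 < Real.tan (θ / 2) :=
    Real.tan_pos_of_pos_of_lt_pi_div_two (by linarith) (by linarith)
  have hle : Real.tan (θ / 2) ≤ 1 := by
    rw [← Real.tan_pi_div_four]
    exact Real.strictMonoOn_tan.monotoneOn ⟨by linarith, by linarith⟩ ⟨by linarith, by linarith⟩
      (by linarith)
  obtain ⟨x, hx0, hx1, hx⟩ := exists_touching_quads hpos hle
  refine ⟨fun i => (x i).point, fun i => (x i).direction (Real.tan (θ / 2)),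
    fun i => Quad.direction_ne_zero, fun i j hij => ?_, fun i j hij => ?_, ?_⟩
  · rcases hij.lt_or_gt with h | h
    · exact Quad.linearIndependent_direction hpos (hx i j h).1
    · exact LinearIndependent.pair_symm_iff.1
        (Quad.linearIndependent_direction hpos (hx j i h).1)
  · rcases hij.lt_or_gt with h | h
    · exact Quad.lineDist_eq_two hpos (hx i j h).1 (hx i j h).2
    · rw [lineDist_comm]
      exact Quad.lineDist_eq_two hpos (hx j i h).1 (hx j i h).2
  · simp only [hx0, hx1]
    exact angle_direction h0 (by linarith) rfl

/-- The 7*-knot admits one residual degree of freedom: for every scissor angle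
`θ ∈ (0, π)` there is a configuration of seven mutually touching unit-radius
cylinders in which the angle between the axes of the 0th and 1st cylinders is `θ`. -/
theorem stmt9 :
    ∀ θ ∈ Set.Ioo (0 : ℝ) Real.pi,
      ∃ p v : Fin 7 → EuclideanSpace ℝ (Fin 3),
        (∀ i, v i ≠ 0) ∧
        (∀ i j, i ≠ j → LinearIndependent ℝ ![v i, v j]) ∧
        (∀ i j, i ≠ j → lineDist (p i) (v i) (p j) (v j) = 2) ∧
        InnerProductGeometry.angle (v 0) (v 1) = θ := by
  rintro θ ⟨h0, hpi⟩
  rcases le_total θ (Real.pi / 2) with hθ | hθ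
  · exact exists_configuration_of_le h0 hθ
  obtain ⟨p, v, hv, hli, hd, hang⟩ :=
    exists_configuration_of_le (θ := Real.pi - θ) (by linarith) (by linarith)
  refine ⟨p, Function.update v 1 (-v 1), fun i => ?_, fun i j hij => ?_, fun i j hij => ?_, ?_⟩
  · rcases eq_or_ne i 1 with rfl | hi <;> simp [*]
  · have := hli i j hij
    rcases eq_or_ne i 1 with rfl | hi
    · simpa [Function.update_of_ne hij.symm] using this
    · rcases eq_or_ne j 1 with rfl | hj <;> simp [*]
  · have := hd i j hij
    rcases eq_or_ne i 1 with rfl | hi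
    · simpa [Function.update_of_ne hij.symm, lineDist_neg_left] using this
    · rcases eq_or_ne j 1 with rfl | hj <;> simp [*, lineDist_neg_right]
  · rw [Function.update_self, Function.update_of_ne (by decide),
      InnerProductGeometry.angle_neg_right, hang, sub_sub_cancel]
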